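/- Let A be a smooth majority free finite idempotent algebra omitting type 1. Then every maximal element of A is as-maximal (max(A) ⊆ amax(A)), and A has exactly one as-component: all as-maximal elements lie in a single strongly connected component of Gas(A). -/

import Mathlib

/-! Common framework: universal algebras over a fixed signature, terms,
subalgebras, congruences, quotients, edges and their types (Bulatov's
coloured-graph approach), thin edges, connectivity, products, etc. -/

/-- A (functional) signature: a type of operation symbols with arities. -/
structure Signature where
  ops : Type
  arity : ops → ℕ

/-- An algebra of a given signature. -/
structure UAlgebra (σ : Signature) where
  carrier : Type
  interp : ∀ f : σ.ops, (Fin (σ.arity f) → carrier) → carrier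

/-- Terms over the signature `σ` in `n` variables. -/
inductive Term (σ : Signature) (n : ℕ) where
  | var : Fin n → Term σ n
  | app : (f : σ.ops) → (Fin (σ.arity f) → Term σ n) → Term σ n

/-- Evaluation of a term in an algebra; term operations of an algebra are
exactly the operations of the form `Term.eval A t`. -/
def Term.eval {σ : Signature} {n : ℕ} (A : UAlgebra σ) :
    Term σ n → (Fin n → A.carrier) → A.carrier
  | .var i, x => x i
  | .app f ts, x => A.interp f fun j => Term.eval A (ts j) x

namespace UAlgebra

variable {σ : Signature}

/-- An algebra is idempotent if all its basic operations are. -/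
def Idempotent (A : UAlgebra σ) : Prop :=
  ∀ (f : σ.ops) (a : A.carrier), A.interp f (fun _ => a) = a

/-- A set closed under all basic operations. -/
def IsClosed (A : UAlgebra σ) (S : Set A.carrier) : Prop :=
  ∀ (f : σ.ops) (x : Fin (σ.arity f) → A.carrier), (∀ j, x j ∈ S) → A.interp f x ∈ S

/-- Closure of a set under the basic operations. -/
inductive Closure (A : UAlgebra σ) (S : Set A.carrier) : A.carrier → Prop
  | base {a : A.carrier} : a ∈ S → Closure A S a
  | app (f : σ.ops) (x : Fin (σ.arity f) → A.carrier) :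
      (∀ j, Closure A S (x j)) → Closure A S (A.interp f x)

def ClosureSet (A : UAlgebra σ) (S : Set A.carrier) : Set A.carrier := {x | Closure A S x}

theorem closureSet_isClosed (A : UAlgebra σ) (S : Set A.carrier) :
    A.IsClosed (A.ClosureSet S) := fun f x h => Closure.app f x h

/-- The subalgebra of `A` on a closed subset `S`. -/
def subalg (A : UAlgebra σ) (S : Set A.carrier) (hS : A.IsClosed S) : UAlgebra σ where
  carrier := {x : A.carrier // x ∈ S}
  interp f x := ⟨A.interp f fun j => (x j : A.carrier), hS f _ fun j => (x j).2⟩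

/-- The subalgebra generated by a set `S`. -/
def Sg (A : UAlgebra σ) (S : Set A.carrier) : UAlgebra σ :=
  A.subalg (A.ClosureSet S) (A.closureSet_isClosed S)

/-- `a` as an element of `Sg {a, b}`. -/
def sgA (A : UAlgebra σ) (a b : A.carrier) : (A.Sg {a, b}).carrier :=
  ⟨a, Closure.base (Set.mem_insert a {b})⟩

/-- `b` as an element of `Sg {a, b}`. -/
def sgB (A : UAlgebra σ) (a b : A.carrier) : (A.Sg {a, b}).carrier :=
  ⟨b, Closure.base (Set.mem_insert_iff.mpr (Or.inr rfl))⟩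

/-- A congruence of an algebra. -/
structure Congruence (A : UAlgebra σ) where
  rel : A.carrier → A.carrier → Prop
  refl : ∀ x, rel x x
  symm : ∀ {x y}, rel x y → rel y x
  trans : ∀ {x y z}, rel x y → rel y z → rel x z
  compat : ∀ (f : σ.ops) (x y : Fin (σ.arity f) → A.carrier),
      (∀ j, rel (x j) (y j)) → rel (A.interp f x) (A.interp f y)

def Congruence.toSetoid {A : UAlgebra σ} (θ : Congruence A) : Setoid A.carrier :=
  ⟨θ.rel, ⟨θ.refl, θ.symm, θ.trans⟩⟩

/-- The full congruence. -/
def Congruence.IsFull {A : UAlgebra σ} (θ : Congruence A) : Prop := ∀ x y, θ.rel x y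

def Congruence.le {A : UAlgebra σ} (θ η : Congruence A) : Prop :=
  ∀ x y, θ.rel x y → η.rel x y

/-- A maximal congruence: proper, and any congruence above it is full or below it. -/
def Congruence.IsMaximal {A : UAlgebra σ} (θ : Congruence A) : Prop :=
  ¬ θ.IsFull ∧ ∀ η : Congruence A, θ.le η → ¬ η.IsFull → η.le θ

/-- The quotient (factor) algebra. -/
noncomputable def quot (A : UAlgebra σ) (θ : Congruence A) : UAlgebra σ where
  carrier := Quotient θ.toSetoid
  interp f x := Quotient.mk θ.toSetoid (A.interp f fun j => (x j).out)

/-- The class of `a` in the quotient of `Sg {a,b}` by `θ`. -/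
def qa (A : UAlgebra σ) (a b : A.carrier) (θ : Congruence (A.Sg {a, b})) :
    ((A.Sg {a, b}).quot θ).carrier :=
  Quotient.mk θ.toSetoid (A.sgA a b)

def qb (A : UAlgebra σ) (a b : A.carrier) (θ : Congruence (A.Sg {a, b})) :
    ((A.Sg {a, b}).quot θ).carrier :=
  Quotient.mk θ.toSetoid (A.sgB a b)

end UAlgebra

/-- A binary operation is a semilattice operation on a set `B`. -/
def IsSemilatticeOn {α : Type} (f : α → α → α) (B : Set α) : Prop :=
  (∀ x ∈ B, f x x = x) ∧ (∀ x ∈ B, ∀ y ∈ B, f x y = f y x) ∧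
    (∀ x ∈ B, ∀ y ∈ B, ∀ z ∈ B, f x (f y z) = f (f x y) z)

/-- A ternary operation is a majority operation on a set `B`. -/
def IsMajorityOn {α : Type} (g : α → α → α → α) (B : Set α) : Prop :=
  ∀ x ∈ B, ∀ y ∈ B, g x x y = x ∧ g x y x = x ∧ g y x x = x

/-- A ternary operation is a Mal'tsev operation on a set `B`. -/
def IsMaltsevOn {α : Type} (h : α → α → α → α) (B : Set α) : Prop :=
  ∀ x ∈ B, ∀ y ∈ B, h x y y = x ∧ h y y x = x

namespace UAlgebra

variable {σ : Signature}

/-- An algebra is "a set": every term operation is a projection. -/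
def IsSetAlgebra (Q : UAlgebra σ) : Prop :=
  ∀ (n : ℕ) (t : Term σ n), ∃ i : Fin n, ∀ x : Fin n → Q.carrier, t.eval Q x = x i

/-- An algebra is the full idempotent reduct of a module over some finite ring:
its term operations are exactly the idempotent affine combinations; in
particular the affine operation `x - y + z` is a term operation. -/
def IsAffineAlgebra (Q : UAlgebra σ) : Prop :=
  ∃ (R : Type) (_ : Ring R) (_ : Finite R) (_ : AddCommGroup Q.carrier)
    (_ : Module R Q.carrier),
    (∀ (n : ℕ) (g : (Fin n → Q.carrier) → Q.carrier),
      (∃ t : Term σ n, ∀ x, t.eval Q x = g x) ↔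
      (∃ c : Fin n → R, (∑ i, c i) = 1 ∧ ∀ x, g x = ∑ i, c i • x i)) ∧
    (∃ t : Term σ 3, ∀ x y z : Q.carrier, t.eval Q ![x, y, z] = x - y + z)

/-- `θ` witnesses that `ab` is an edge of the unary type. -/
def UnaryWitness (A : UAlgebra σ) (a b : A.carrier) (θ : Congruence (A.Sg {a, b})) : Prop :=
  θ.IsMaximal ∧ IsSetAlgebra ((A.Sg {a, b}).quot θ)

/-- `θ` witnesses that `ab` is an edge of the semilattice type. -/
def SLWitness (A : UAlgebra σ) (a b : A.carrier) (θ : Congruence (A.Sg {a, b})) : Prop :=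
  θ.IsMaximal ∧ ∃ t : Term σ 2,
    IsSemilatticeOn (fun x y => t.eval ((A.Sg {a, b}).quot θ) ![x, y])
      {A.qa a b θ, A.qb a b θ}

/-- `θ` witnesses that `ab` is an edge of the majority type. -/
def MajWitness (A : UAlgebra σ) (a b : A.carrier) (θ : Congruence (A.Sg {a, b})) : Prop :=
  θ.IsMaximal ∧
  (∃ t : Term σ 3,
    IsMajorityOn (fun x y z => t.eval ((A.Sg {a, b}).quot θ) ![x, y, z])
      {A.qa a b θ, A.qb a b θ}) ∧
  ¬ (∃ t : Term σ 2,
    IsSemilatticeOn (fun x y => t.eval ((A.Sg {a, b}).quot θ) ![x, y])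
      {A.qa a b θ, A.qb a b θ})

/-- `θ` witnesses that `ab` is an edge of the affine type. -/
def AffWitness (A : UAlgebra σ) (a b : A.carrier) (θ : Congruence (A.Sg {a, b})) : Prop :=
  θ.IsMaximal ∧ IsAffineAlgebra ((A.Sg {a, b}).quot θ)

/-- A pair of distinct elements is an edge. -/
def IsEdge (A : UAlgebra σ) (a b : A.carrier) : Prop :=
  a ≠ b ∧ ∃ θ : Congruence (A.Sg {a, b}), ¬ θ.IsFull ∧
    (IsSetAlgebra ((A.Sg {a, b}).quot θ) ∨
     IsAffineAlgebra ((A.Sg {a, b}).quot θ) ∨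
     (∃ t : Term σ 2,
        IsSemilatticeOn (fun x y => t.eval ((A.Sg {a, b}).quot θ) ![x, y])
          {A.qa a b θ, A.qb a b θ}) ∨
     (∃ t : Term σ 3,
        IsMajorityOn (fun x y z => t.eval ((A.Sg {a, b}).quot θ) ![x, y, z])
          {A.qa a b θ, A.qb a b θ}))

def IsUnaryEdge (A : UAlgebra σ) (a b : A.carrier) : Prop :=
  a ≠ b ∧ ∃ θ : Congruence (A.Sg {a, b}), UnaryWitness A a b θ

def IsSLEdge (A : UAlgebra σ) (a b : A.carrier) : Prop :=
  a ≠ b ∧ ∃ θ : Congruence (A.Sg {a, b}), SLWitness A a b θ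

def IsMajEdge (A : UAlgebra σ) (a b : A.carrier) : Prop :=
  a ≠ b ∧ ∃ θ : Congruence (A.Sg {a, b}), MajWitness A a b θ

def IsAffEdge (A : UAlgebra σ) (a b : A.carrier) : Prop :=
  a ≠ b ∧ ∃ θ : Congruence (A.Sg {a, b}), AffWitness A a b θ

end UAlgebra

/-- The four types of edges. -/
inductive EdgeType where
  | unary | semilattice | majority | affine
deriving DecidableEq

namespace UAlgebra

variable {σ : Signature}

def HasEdgeOfType (A : UAlgebra σ) (τ : EdgeType) (a b : A.carrier) : Prop :=
  match τ with
  | .unary => A.IsUnaryEdge a b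
  | .semilattice => A.IsSLEdge a b
  | .majority => A.IsMajEdge a b
  | .affine => A.IsAffEdge a b

/-- `T`-restricted algebra: every edge has a type from `T`. -/
def Restricted (A : UAlgebra σ) (T : Set EdgeType) : Prop :=
  ∀ a b : A.carrier, A.IsEdge a b → ∃ τ ∈ T, A.HasEdgeOfType τ a b

/-- `A` omits type 1: no subalgebra of `A` has an edge of the unary type. -/
def OmitsType1 (A : UAlgebra σ) : Prop :=
  ∀ (S : Set A.carrier) (hS : A.IsClosed S) (a b : (A.subalg S hS).carrier),
    ¬ (A.subalg S hS).IsUnaryEdge a b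

/-- The union of the two `θ`-blocks of a thick edge, as a subset of `A`. -/
def edgeBlockUnion (A : UAlgebra σ) (a b : A.carrier) (θ : Congruence (A.Sg {a, b})) :
    Set A.carrier :=
  {x | ∃ hx : x ∈ A.ClosureSet {a, b},
    θ.rel ⟨x, hx⟩ (A.sgA a b) ∨ θ.rel ⟨x, hx⟩ (A.sgB a b)}

/-- Smooth algebra: for every semilattice- or majority-type edge with a witnessing
maximal congruence, the union of the two blocks is a subuniverse. -/
def IsSmooth (A : UAlgebra σ) : Prop :=
  ∀ (a b : A.carrier) (θ : Congruence (A.Sg {a, b})),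
    (SLWitness A a b θ ∨ MajWitness A a b θ) → A.IsClosed (A.edgeBlockUnion a b θ)

def SemilatticeFree (A : UAlgebra σ) : Prop := ∀ a b : A.carrier, ¬ A.IsSLEdge a b
def MajorityFree (A : UAlgebra σ) : Prop := ∀ a b : A.carrier, ¬ A.IsMajEdge a b
def AffineFree (A : UAlgebra σ) : Prop := ∀ a b : A.carrier, ¬ A.IsAffEdge a b

/-- Thin semilattice edge. -/
def IsThinSLEdge (A : UAlgebra σ) (a b : A.carrier) : Prop :=
  ∃ t : Term σ 2, t.eval A ![a, a] = a ∧ t.eval A ![a, b] = b ∧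
    t.eval A ![b, a] = b ∧ t.eval A ![b, b] = b

/-- Undirected thin majority edge: some term operation is majority on `{a, b}`. -/
def IsUndirThinMajEdge (A : UAlgebra σ) (a b : A.carrier) : Prop :=
  ∃ t : Term σ 3, IsMajorityOn (fun x y z => t.eval A ![x, y, z]) {a, b}

/-- Mal'tsev edge: some term operation is Mal'tsev on `{a, b}`. -/
def IsMaltsevEdge (A : UAlgebra σ) (a b : A.carrier) : Prop :=
  ∃ t : Term σ 3, IsMaltsevOn (fun x y z => t.eval A ![x, y, z]) {a, b}

/-- The class of all quotients of subalgebras of `A`. -/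
def QuotSub (A : UAlgebra σ) : Set (UAlgebra σ) :=
  {B | ∃ (S : Set A.carrier) (hS : A.IsClosed S)
        (θ : Congruence (A.subalg S hS)), B = (A.subalg S hS).quot θ}

end UAlgebra

/-- The class of all quotients of subalgebras of the algebras of a class. -/
def QuotSubClass {σ : Signature} (K : Set (UAlgebra σ)) : Set (UAlgebra σ) :=
  {B | ∃ A ∈ K, B ∈ UAlgebra.QuotSub A}

/-- A ternary term satisfies the majority condition relative to a class `𝒦`. -/
def MajorityCondition {σ : Signature} (𝒦 : Set (UAlgebra σ)) (t : Term σ 3) : Prop :=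
  (∀ B ∈ 𝒦, ∀ x y : B.carrier,
    t.eval B ![x, t.eval B ![x, y, y], t.eval B ![x, y, y]] = t.eval B ![x, y, y]) ∧
  (∀ B ∈ 𝒦, ∀ (a b : B.carrier) (θ : UAlgebra.Congruence (B.Sg {a, b})),
    a ≠ b → UAlgebra.MajWitness B a b θ →
    IsMajorityOn (fun x y z => t.eval ((B.Sg {a, b}).quot θ) ![x, y, z])
      {B.qa a b θ, B.qb a b θ})

/-- A ternary term satisfies the minority condition relative to a class `𝒦`. -/
def MinorityCondition {σ : Signature} (𝒦 : Set (UAlgebra σ)) (t : Term σ 3) : Prop :=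
  (∀ B ∈ 𝒦, ∀ x y : B.carrier,
    t.eval B ![t.eval B ![x, y, y], y, y] = t.eval B ![x, y, y]) ∧
  (∀ B ∈ 𝒦, ∀ (a b : B.carrier) (θ : UAlgebra.Congruence (B.Sg {a, b})),
    a ≠ b → UAlgebra.AffWitness B a b θ →
    IsMaltsevOn (fun x y z => t.eval ((B.Sg {a, b}).quot θ) ![x, y, z])
      {B.qa a b θ, B.qb a b θ})

/-- Thin majority edge relative to a class `𝒦`. -/
def IsThinMajEdge {σ : Signature} (𝒦 : Set (UAlgebra σ)) (A : UAlgebra σ)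
    (a b : A.carrier) : Prop :=
  ∀ t : Term σ 3, MajorityCondition 𝒦 t →
    b ∈ A.ClosureSet {a, t.eval A ![a, b, b]} ∧
    b ∈ A.ClosureSet {a, t.eval A ![b, a, b]} ∧
    b ∈ A.ClosureSet {a, t.eval A ![b, b, a]}

/-- Thin affine edge relative to a class `𝒦` (with respect to some fixed term
operation satisfying the minority condition). -/
def IsThinAffEdge {σ : Signature} (𝒦 : Set (UAlgebra σ)) (A : UAlgebra σ)
    (a b : A.carrier) : Prop :=
  (∃ t : Term σ 3, MinorityCondition 𝒦 t ∧ t.eval A ![b, a, a] = b) ∧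
  ∀ t : Term σ 3, MinorityCondition 𝒦 t → b ∈ A.ClosureSet {a, t.eval A ![a, a, b]}

namespace UAlgebra

variable {σ : Signature}

/-- Reachability in the digraph `Gs(A)` of thin semilattice edges. -/
def sReach (A : UAlgebra σ) : A.carrier → A.carrier → Prop :=
  Relation.ReflTransGen (fun x y => A.IsThinSLEdge x y)

/-- A maximal element of `Gs(A)`: an element of a maximal strongly connected
component. -/
def IsMaxElem (A : UAlgebra σ) (a : A.carrier) : Prop :=
  ∀ b, A.sReach a b → A.sReach b a

/-- A maximal component of `Gs(A)`: the strongly connected component of a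
maximal element. -/
def IsMaxComponent (A : UAlgebra σ) (C : Set A.carrier) : Prop :=
  ∃ a, A.IsMaxElem a ∧ C = {b | A.sReach a b ∧ A.sReach b a}

end UAlgebra

/-- An arc of the digraph `Gas(A)`: a thin semilattice or thin affine edge. -/
def asStep {σ : Signature} (𝒦 : Set (UAlgebra σ)) (A : UAlgebra σ)
    (x y : A.carrier) : Prop :=
  A.IsThinSLEdge x y ∨ IsThinAffEdge 𝒦 A x y

/-- Reachability in `Gas(A)`. -/
def asReach {σ : Signature} (𝒦 : Set (UAlgebra σ)) (A : UAlgebra σ) :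
    A.carrier → A.carrier → Prop :=
  Relation.ReflTransGen (asStep 𝒦 A)

/-- An as-maximal element: an element of an as-component. -/
def IsAsMaxElem {σ : Signature} (𝒦 : Set (UAlgebra σ)) (A : UAlgebra σ)
    (a : A.carrier) : Prop :=
  ∀ b, asReach 𝒦 A a b → asReach 𝒦 A b a

/-- An as-component of `A`: a maximal strongly connected component of `Gas(A)`. -/
def IsAsComponent {σ : Signature} (𝒦 : Set (UAlgebra σ)) (A : UAlgebra σ)
    (C : Set A.carrier) : Prop :=
  ∃ a, IsAsMaxElem 𝒦 A a ∧ C = {b | asReach 𝒦 A a b ∧ asReach 𝒦 A b a}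

namespace UAlgebra

variable {σ : Signature}

/-- Binary direct product. -/
def prod (A B : UAlgebra σ) : UAlgebra σ where
  carrier := A.carrier × B.carrier
  interp f x := (A.interp f fun j => (x j).1, B.interp f fun j => (x j).2)

/-- Direct product of a family. -/
def pi {ι : Type} (A : ι → UAlgebra σ) : UAlgebra σ where
  carrier := ∀ i, (A i).carrier
  interp f x := fun i => (A i).interp f fun j => x j i

/-- Homomorphism of similar algebras. -/
def IsHom (A B : UAlgebra σ) (φ : A.carrier → B.carrier) : Prop :=
  ∀ (f : σ.ops) (x : Fin (σ.arity f) → A.carrier),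
    φ (A.interp f x) = B.interp f fun j => φ (x j)

/-- Simple algebra: only the equality and full congruences. -/
def IsSimple (A : UAlgebra σ) : Prop :=
  ∀ θ : Congruence A, (∀ x y, θ.rel x y ↔ x = y) ∨ θ.IsFull

/-- Maximal generated algebra: generated by one of its maximal components. -/
def MaximalGenerated (A : UAlgebra σ) : Prop :=
  ∃ C : Set A.carrier, A.IsMaxComponent C ∧ A.ClosureSet C = Set.univ

/-- The number of subalgebras (nonempty closed subsets) of an algebra. -/
noncomputable def numSubalgebras (A : UAlgebra σ) : ℕ :=
  Nat.card {S : Set A.carrier // S.Nonempty ∧ A.IsClosed S}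

end UAlgebra

/-- A (k+3)-ary term is an edge term for a class `𝒦`. -/
def IsEdgeTermFor {σ : Signature} (𝒦 : Set (UAlgebra σ)) {k : ℕ}
    (t : Term σ (k + 3)) : Prop :=
  ∀ A ∈ 𝒦, ∀ x y : A.carrier,
    t.eval A (fun i => if i.val ≤ 1 then y else x) = x ∧
    t.eval A (fun i => if i.val = 0 ∨ i.val = 2 then y else x) = x ∧
    ∀ j : Fin (k + 3), 3 ≤ j.val →
      t.eval A (Function.update (fun _ => x) j y) = x

/-- A finite class has few subproducts. -/
def FewSubproducts {σ : Signature} (K : Set (UAlgebra σ)) : Prop :=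
  ∃ p : Polynomial ℕ, ∀ (n : ℕ) (A : Fin n → UAlgebra σ), (∀ i, A i ∈ K) →
    UAlgebra.numSubalgebras (UAlgebra.pi A) ≤ 2 ^ (p.eval n)

/-- `g_K` is bounded by a polynomial: every subalgebra of an `n`-fold product
of members of `K` has a generating set of polynomial size. -/
def PolyGenerated {σ : Signature} (K : Set (UAlgebra σ)) : Prop :=
  ∃ p : Polynomial ℕ, ∀ (n : ℕ) (A : Fin n → UAlgebra σ), (∀ i, A i ∈ K) →
    ∀ S : Set (UAlgebra.pi A).carrier, S.Nonempty → (UAlgebra.pi A).IsClosed S →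
      ∃ G : Set (UAlgebra.pi A).carrier, G ⊆ S ∧ G.Finite ∧
        G.ncard ≤ p.eval n ∧ (UAlgebra.pi A).ClosureSet G = S

namespace Term

variable {σ : Signature}

/-- Simultaneous substitution of terms for variables. -/
def subst {n m : ℕ} : Term σ n → (Fin n → Term σ m) → Term σ m
  | .var i, s => s i
  | .app f ts, s => .app f fun j => subst (ts j) s

theorem eval_subst {n m : ℕ} (Q : UAlgebra σ) (t : Term σ n) (s : Fin n → Term σ m)
    (v : Fin m → Q.carrier) :
    (t.subst s).eval Q v = t.eval Q fun i => (s i).eval Q v := by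
  induction t with
  | var i => rfl
  | app f ts ih =>
    simp only [subst, eval]
    congr 1
    funext j
    exact ih j

@[simp] theorem eval_var {n : ℕ} (Q : UAlgebra σ) (i : Fin n) (v : Fin n → Q.carrier) :
    (Term.var i : Term σ n).eval Q v = v i := rfl

/-- Substitution into a binary term. -/
def comp2 {m : ℕ} (t : Term σ 2) (a b : Term σ m) : Term σ m := t.subst ![a, b]

/-- Substitution into a ternary term. -/
def comp3 {m : ℕ} (t : Term σ 3) (a b c : Term σ m) : Term σ m := t.subst ![a, b, c]

@[simp] theorem eval_comp2 {m : ℕ} (Q : UAlgebra σ) (t : Term σ 2) (a b : Term σ m)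
    (v : Fin m → Q.carrier) :
    (t.comp2 a b).eval Q v = t.eval Q ![a.eval Q v, b.eval Q v] := by
  rw [comp2, eval_subst]
  congr 1
  funext i
  fin_cases i <;> rfl

@[simp] theorem eval_comp3 {m : ℕ} (Q : UAlgebra σ) (t : Term σ 3) (a b c : Term σ m)
    (v : Fin m → Q.carrier) :
    (t.comp3 a b c).eval Q v = t.eval Q ![a.eval Q v, b.eval Q v, c.eval Q v] := by
  rw [comp3, eval_subst]
  congr 1
  funext i
  fin_cases i <;> rfl

end Term

namespace UAlgebra

variable {σ : Signature}

theorem Idempotent.eval_const {Q : UAlgebra σ} (hQ : Q.Idempotent) {n : ℕ} (t : Term σ n)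
    (a : Q.carrier) : (t.eval Q fun _ => a) = a := by
  induction t with
  | var i => rfl
  | app f ts ih =>
    simp only [Term.eval, ih]
    exact hQ f a

theorem Idempotent.eval2 {Q : UAlgebra σ} (hQ : Q.Idempotent) (t : Term σ 2)
    (a : Q.carrier) : t.eval Q ![a, a] = a := by
  rw [show ![a, a] = fun _ => a by funext i; fin_cases i <;> rfl]
  exact hQ.eval_const t a

theorem Idempotent.eval3 {Q : UAlgebra σ} (hQ : Q.Idempotent) (t : Term σ 3)
    (a : Q.carrier) : t.eval Q ![a, a, a] = a := by
  rw [show ![a, a, a] = fun _ => a by funext i; fin_cases i <;> rfl]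
  exact hQ.eval_const t a

theorem IsHom.eval {A B : UAlgebra σ} {φ : A.carrier → B.carrier} (hφ : IsHom A B φ) {n : ℕ}
    (t : Term σ n) (v : Fin n → A.carrier) : φ (t.eval A v) = t.eval B fun i => φ (v i) := by
  induction t with
  | var i => rfl
  | app f ts ih =>
    simp only [Term.eval]
    rw [hφ]
    congr 1
    funext j
    exact ih j

theorem IsHom.eval2 {A B : UAlgebra σ} {φ : A.carrier → B.carrier} (hφ : IsHom A B φ)
    (t : Term σ 2) (x y : A.carrier) : φ (t.eval A ![x, y]) = t.eval B ![φ x, φ y] := by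
  rw [hφ.eval]
  congr 1
  funext i
  fin_cases i <;> rfl

theorem IsHom.eval3 {A B : UAlgebra σ} {φ : A.carrier → B.carrier} (hφ : IsHom A B φ)
    (t : Term σ 3) (x y z : A.carrier) :
    φ (t.eval A ![x, y, z]) = t.eval B ![φ x, φ y, φ z] := by
  rw [hφ.eval]
  congr 1
  funext i
  fin_cases i <;> rfl

theorem IsClosed.eval {Q : UAlgebra σ} {D : Set Q.carrier} (hD : Q.IsClosed D) {n : ℕ}
    (t : Term σ n) (v : Fin n → Q.carrier) (hv : ∀ i, v i ∈ D) : t.eval Q v ∈ D := by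
  induction t with
  | var i => exact hv i
  | app f ts ih => exact hD f _ ih

theorem IsClosed.eval2 {Q : UAlgebra σ} {D : Set Q.carrier} (hD : Q.IsClosed D)
    (t : Term σ 2) {x y : Q.carrier} (hx : x ∈ D) (hy : y ∈ D) : t.eval Q ![x, y] ∈ D :=
  hD.eval t _ fun i => by fin_cases i <;> assumption

theorem IsClosed.eval3 {Q : UAlgebra σ} {D : Set Q.carrier} (hD : Q.IsClosed D)
    (t : Term σ 3) {x y z : Q.carrier} (hx : x ∈ D) (hy : y ∈ D) (hz : z ∈ D) :
    t.eval Q ![x, y, z] ∈ D :=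
  hD.eval t _ fun i => by fin_cases i <;> assumption

theorem ClosureSet_subset {Q : UAlgebra σ} {S D : Set Q.carrier} (hD : Q.IsClosed D)
    (h : S ⊆ D) : Q.ClosureSet S ⊆ D := by
  intro x hx
  induction hx with
  | base ha => exact h ha
  | app f x _ ih => exact hD f x ih

/-- The set of values of `n`-ary terms at a fixed tuple is closed. -/
theorem isClosed_range_eval (Q : UAlgebra σ) {n : ℕ} (v : Fin n → Q.carrier) :
    Q.IsClosed {x | ∃ t : Term σ n, t.eval Q v = x} := by
  intro f x hx
  choose t ht using hx
  refine ⟨.app f t, ?_⟩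
  simp only [Term.eval, ht]

theorem mem_closureSet_pair {Q : UAlgebra σ} {a b x : Q.carrier} :
    x ∈ Q.ClosureSet {a, b} ↔ ∃ t : Term σ 2, t.eval Q ![a, b] = x := by
  constructor
  · intro h
    refine ClosureSet_subset (isClosed_range_eval Q ![a, b]) ?_ h
    rintro y (rfl | rfl)
    · exact ⟨.var 0, rfl⟩
    · exact ⟨.var 1, rfl⟩
  · rintro ⟨t, rfl⟩
    exact (Q.closureSet_isClosed {a, b}).eval2 t (Closure.base (by simp)) (Closure.base (by simp))

/-- A binary relation preserved by all term operations. -/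
def Compat (Q : UAlgebra σ) (R : Q.carrier → Q.carrier → Prop) : Prop :=
  ∀ (f : σ.ops) (u v : Fin (σ.arity f) → Q.carrier), (∀ j, R (u j) (v j)) →
    R (Q.interp f u) (Q.interp f v)

namespace Compat

variable {Q : UAlgebra σ} {R S : Q.carrier → Q.carrier → Prop}

theorem eval (hR : Q.Compat R) {n : ℕ} (t : Term σ n) (u v : Fin n → Q.carrier)
    (h : ∀ i, R (u i) (v i)) : R (t.eval Q u) (t.eval Q v) := by
  induction t with
  | var i => exact h i
  | app f ts ih => exact hR f _ _ ih

theorem eval2 (hR : Q.Compat R) (t : Term σ 2) {x y x' y' : Q.carrier} (hx : R x x')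
    (hy : R y y') : R (t.eval Q ![x, y]) (t.eval Q ![x', y']) :=
  hR.eval t _ _ fun i => by fin_cases i <;> assumption

theorem eval3 (hR : Q.Compat R) (t : Term σ 3) {x y z x' y' z' : Q.carrier} (hx : R x x')
    (hy : R y y') (hz : R z z') : R (t.eval Q ![x, y, z]) (t.eval Q ![x', y', z']) :=
  hR.eval t _ _ fun i => by fin_cases i <;> assumption

theorem swap (hR : Q.Compat R) : Q.Compat fun x y => R y x :=
  fun f u v h => hR f v u h

theorem comp (hR : Q.Compat R) (hS : Q.Compat S) :
    Q.Compat fun x y => ∃ z, R x z ∧ S z y := by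
  intro f u v h
  choose z hz using h
  exact ⟨Q.interp f z, hR f _ _ fun j => (hz j).1, hS f _ _ fun j => (hz j).2⟩

theorem fiber (hR : Q.Compat R) (hQ : Q.Idempotent) (x : Q.carrier) :
    Q.IsClosed {y | R x y} := by
  intro f v hv
  have := hR f (fun _ => x) v hv
  rwa [hQ] at this

theorem all_fiber (hR : Q.Compat R) (hQ : Q.Idempotent) (D : Set Q.carrier) :
    Q.IsClosed {x | ∀ y ∈ D, R x y} := by
  intro f v hv y hy
  have := hR f v (fun _ => y) fun j => hv j y hy
  rwa [hQ] at this

end Compat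

/-- The compatible relation generated by the pairs `(u i, v i)`. -/
def Gen (Q : UAlgebra σ) {n : ℕ} (u v : Fin n → Q.carrier) (x y : Q.carrier) : Prop :=
  ∃ t : Term σ n, t.eval Q u = x ∧ t.eval Q v = y

theorem gen_compat (Q : UAlgebra σ) {n : ℕ} (u v : Fin n → Q.carrier) : Q.Compat (Q.Gen u v) := by
  intro f x y h
  choose t ht using h
  refine ⟨.app f t, ?_, ?_⟩
  · simp only [Term.eval, fun j => (ht j).1]
  · simp only [Term.eval, fun j => (ht j).2]

theorem gen_base (Q : UAlgebra σ) {n : ℕ} (u v : Fin n → Q.carrier) (i : Fin n) :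
    Q.Gen u v (u i) (v i) := ⟨.var i, rfl, rfl⟩

theorem Gen.least {Q : UAlgebra σ} {n : ℕ} {u v : Fin n → Q.carrier}
    {R : Q.carrier → Q.carrier → Prop} (hR : Q.Compat R) (h : ∀ i, R (u i) (v i))
    {x y : Q.carrier} (hxy : Q.Gen u v x y) : R x y := by
  obtain ⟨t, rfl, rfl⟩ := hxy
  exact hR.eval t u v h

theorem subalg_val_isHom (A : UAlgebra σ) (S : Set A.carrier) (hS : A.IsClosed S) :
    IsHom (A.subalg S hS) A Subtype.val := fun _ _ => rfl

theorem quot_mk_isHom (A : UAlgebra σ) (θ : Congruence A) :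
    IsHom A (A.quot θ) (Quotient.mk θ.toSetoid) := by
  intro f x
  apply Quotient.sound
  apply θ.compat
  intro j
  exact θ.symm (Quotient.exact (s := θ.toSetoid) (Quotient.out_eq _))

theorem Idempotent.subalg {A : UAlgebra σ} (hA : A.Idempotent) (S : Set A.carrier)
    (hS : A.IsClosed S) : (A.subalg S hS).Idempotent :=
  fun f a => Subtype.ext (hA f a.1)

theorem IsHom.idempotent {A B : UAlgebra σ} {φ : A.carrier → B.carrier} (hφ : IsHom A B φ)
    (hs : Function.Surjective φ) (hA : A.Idempotent) : B.Idempotent := by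
  intro f b
  obtain ⟨a, rfl⟩ := hs b
  rw [← hφ f fun _ => a, hA]

theorem Idempotent.quot {A : UAlgebra σ} (hA : A.Idempotent) (θ : Congruence A) :
    (A.quot θ).Idempotent :=
  (quot_mk_isHom A θ).idempotent Quotient.mk_surjective hA

theorem IsHom.comp {A B C : UAlgebra σ} {φ : A.carrier → B.carrier} {ψ : B.carrier → C.carrier}
    (hψ : IsHom B C ψ) (hφ : IsHom A B φ) : IsHom A C (ψ ∘ φ) := by
  intro f x
  simp only [Function.comp, hφ f, hψ f]

theorem IsHom.fiber_closed {A B : UAlgebra σ} {φ : A.carrier → B.carrier} (hφ : IsHom A B φ)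
    (hB : B.Idempotent) (b : B.carrier) : A.IsClosed {x | φ x = b} := by
  intro f x hx
  change φ _ = b
  rw [hφ, show (fun j => φ (x j)) = fun _ => b from funext hx]
  exact hB f b

/-- The kernel of a homomorphism. -/
def IsHom.ker {A B : UAlgebra σ} {φ : A.carrier → B.carrier} (hφ : IsHom A B φ) :
    Congruence A where
  rel x y := φ x = φ y
  refl _ := rfl
  symm h := h.symm
  trans h h' := h.trans h'
  compat f x y h := by rw [hφ, hφ]; simp only [h]

theorem singleton_closed {Q : UAlgebra σ} (hQ : Q.Idempotent) (a : Q.carrier) :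
    Q.IsClosed {a} := by
  intro f x hx
  have : x = fun _ => a := funext hx
  rw [this, hQ]
  rfl

end UAlgebra

theorem exists_pos_iterate_idem {α : Type*} [Finite α] (g : α → α) :
    ∃ N, 0 < N ∧ ∀ a, g^[N] (g^[N] a) = g^[N] a := by
  obtain ⟨i, j, hij, h⟩ := Finite.exists_ne_map_eq_of_infinite fun n : ℕ => g^[n]
  wlog hlt : i < j generalizing i j
  · exact this j i hij.symm h.symm (lt_of_le_of_ne (not_lt.mp hlt) hij.symm)
  obtain ⟨p, rfl⟩ := Nat.exists_eq_add_of_le hlt.le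
  have hp : 0 < p := by omega
  have step : ∀ n, i ≤ n → g^[n + p] = g^[n] := by
    intro n hn
    obtain ⟨k, rfl⟩ := Nat.exists_eq_add_of_le hn
    rw [show i + k + p = k + (i + p) by omega, Function.iterate_add, ← h, ← Function.iterate_add,
      add_comm]
  have steps : ∀ k n, i ≤ n → g^[n + k * p] = g^[n] := by
    intro k
    induction k with
    | zero => simp
    | succ k ih =>
      intro n hn
      rw [show n + (k + 1) * p = (n + k * p) + p by ring, step _ (by omega), ih n hn]
  refine ⟨(i + 1) * p, by positivity, fun a => ?_⟩
  rw [← Function.iterate_add_apply, steps (i + 1) _ (by nlinarith)]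

namespace Term

variable {σ : Signature}

/-- The `k`-fold iterate of a binary term in its second variable. -/
def iter (T : Term σ 2) : ℕ → Term σ 2
  | 0 => var 1
  | k + 1 => T.comp2 (var 0) (iter T k)

theorem eval_iter (Q : UAlgebra σ) (T : Term σ 2) (k : ℕ) (x y : Q.carrier) :
    (T.iter k).eval Q ![x, y] = (fun z => T.eval Q ![x, z])^[k] y := by
  induction k with
  | zero => rfl
  | succ k ih =>
    rw [Function.iterate_succ_apply', ← ih]
    simp [iter]

theorem exists_iter_idem (Q : UAlgebra σ) [Finite Q.carrier] (T : Term σ 2) :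
    ∃ N, 0 < N ∧ ∀ x y, (T.iter N).eval Q ![x, (T.iter N).eval Q ![x, y]] =
      (T.iter N).eval Q ![x, y] := by
  obtain ⟨N, hN, h⟩ := exists_pos_iterate_idem
    fun p : Q.carrier × Q.carrier => (p.1, T.eval Q ![p.1, p.2])
  have key : ∀ k (x y : Q.carrier), (fun p : Q.carrier × Q.carrier =>
      (p.1, T.eval Q ![p.1, p.2]))^[k] (x, y) = (x, (T.iter k).eval Q ![x, y]) := by
    intro k x y
    rw [eval_iter]
    induction k with
    | zero => rfl
    | succ k ih => rw [Function.iterate_succ_apply', Function.iterate_succ_apply', ih]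
  refine ⟨N, hN, fun x y => ?_⟩
  have := h (x, y)
  rw [key, key] at this
  exact congrArg Prod.snd this

end Term

namespace UAlgebra

variable {σ : Signature}

theorem IsHom.thin {A B : UAlgebra σ} {φ : A.carrier → B.carrier} (hφ : IsHom A B φ)
    {x y : A.carrier} (h : A.IsThinSLEdge x y) : B.IsThinSLEdge (φ x) (φ y) := by
  obtain ⟨t, h1, h2, h3, h4⟩ := h
  exact ⟨t, by rw [← hφ.eval2, h1], by rw [← hφ.eval2, h2], by rw [← hφ.eval2, h3],
    by rw [← hφ.eval2, h4]⟩

theorem IsHom.sReach {A B : UAlgebra σ} {φ : A.carrier → B.carrier} (hφ : IsHom A B φ)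
    {x y : A.carrier} (h : A.sReach x y) : B.sReach (φ x) (φ y) :=
  Relation.ReflTransGen.lift φ (fun _ _ h => hφ.thin h) _ _ h

/-- Every binary term can be turned into one moving upwards along thin semilattice edges
while keeping the absorption properties of the original term. -/
theorem exists_push {Q : UAlgebra σ} [Finite Q.carrier] (hQ : Q.Idempotent) (T : Term σ 2) :
    ∃ f : Term σ 2, (∀ x y, Q.IsThinSLEdge x (f.eval Q ![x, y])) ∧
      ∀ (D : Set Q.carrier), Q.IsClosed D → ∀ x,
        (∀ d ∈ D, T.eval Q ![x, d] ∈ D ∧ T.eval Q ![d, x] ∈ D) →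
        ∀ d ∈ D, f.eval Q ![x, d] ∈ D := by
  obtain ⟨N, hN, hT⟩ := T.exists_iter_idem Q
  set T1 := T.iter N with hT1
  let V : Term σ 2 := T1.comp2 (.var 0) (T1.comp2 (.var 1) (.var 0))
  have hV : ∀ x y, V.eval Q ![x, y] = T1.eval Q ![x, T1.eval Q ![y, x]] := by
    intro x y; simp [V]
  obtain ⟨M, hM, hW⟩ := V.exists_iter_idem Q
  refine ⟨V.iter M, fun x y => ?_, fun D hD x hx => ?_⟩
  · set z := (V.iter M).eval Q ![x, y] with hz
    have h1 : (V.iter M).eval Q ![x, z] = z := hW x y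
    have h2 : T1.eval Q ![x, z] = z := by
      obtain ⟨M', rfl⟩ := Nat.exists_eq_add_one_of_ne_zero hM.ne'
      have : z = T1.eval Q ![x, T1.eval Q ![(V.iter M').eval Q ![x, y], x]] := by
        rw [← hV, hz, Term.eval_iter, Function.iterate_succ_apply', ← Term.eval_iter]
      rw [this, hT]
    have h3 : V.eval Q ![z, x] = z := by rw [hV, h2, hQ.eval2]
    refine ⟨V.iter M, hQ.eval2 _ _, h1, ?_, hQ.eval2 _ _⟩
    obtain ⟨M', rfl⟩ := Nat.exists_eq_add_one_of_ne_zero hM.ne'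
    rw [Term.eval_iter, Function.iterate_succ_apply, h3]
    exact Function.iterate_fixed (hQ.eval2 V z) _
  · have hr : ∀ d ∈ D, T1.eval Q ![x, d] ∈ D := by
      intro d hd
      rw [hT1]
      clear_value T1
      clear hT hV hW hT1 hN
      induction N with
      | zero => exact hd
      | succ k ih => simpa [Term.iter] using (hx _ ih).1
    have hl : ∀ d ∈ D, T1.eval Q ![d, x] ∈ D := by
      intro d hd
      rw [hT1, Term.eval_iter]
      obtain ⟨N', rfl⟩ := Nat.exists_eq_add_one_of_ne_zero hN.ne'
      rw [Function.iterate_succ_apply]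
      refine Set.MapsTo.iterate (s := D) (fun d' hd' => hD.eval2 T hd hd') N' (hx d hd).2
    intro d hd
    rw [Term.eval_iter]
    refine Set.MapsTo.iterate (s := D) (fun d' hd' => ?_) M hd
    simp only [hV]
    exact hr _ (hl _ hd')

theorem exists_push_thin {Q : UAlgebra σ} [Finite Q.carrier] (hQ : Q.Idempotent)
    {x x' : Q.carrier} (h : Q.IsThinSLEdge x x') :
    ∃ f : Term σ 2, (∀ x y, Q.IsThinSLEdge x (f.eval Q ![x, y])) ∧ f.eval Q ![x, x'] = x' := by
  obtain ⟨T, -, h2, h3, -⟩ := h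
  obtain ⟨f, hf, hD⟩ := exists_push hQ T
  refine ⟨f, hf, hD {x'} (singleton_closed hQ x') x ?_ x' rfl⟩
  rintro d rfl
  exact ⟨h2, h3⟩

theorem Compat.lift_thin {Q : UAlgebra σ} [Finite Q.carrier] (hQ : Q.Idempotent)
    {R : Q.carrier → Q.carrier → Prop} (hR : Q.Compat R) (htot : ∀ x, ∃ y, R x y)
    {x x' y : Q.carrier} (hxy : R x y) (h : Q.IsThinSLEdge x x') :
    ∃ y', Q.IsThinSLEdge y y' ∧ R x' y' := by
  obtain ⟨f, hf, hx'⟩ := exists_push_thin hQ h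
  obtain ⟨y0, hy0⟩ := htot x'
  exact ⟨f.eval Q ![y, y0], hf _ _, hx' ▸ hR.eval2 f hxy hy0⟩

theorem Compat.lift_sReach {Q : UAlgebra σ} [Finite Q.carrier] (hQ : Q.Idempotent)
    {R : Q.carrier → Q.carrier → Prop} (hR : Q.Compat R) (htot : ∀ x, ∃ y, R x y)
    {x x' y : Q.carrier} (hxy : R x y) (h : Q.sReach x x') :
    ∃ y', Q.sReach y y' ∧ R x' y' := by
  induction h with
  | refl => exact ⟨y, .refl, hxy⟩
  | tail _ hs ih =>
    obtain ⟨y1, h1, h2⟩ := ih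
    obtain ⟨y2, h3, h4⟩ := hR.lift_thin hQ htot h2 hs
    exact ⟨y2, h1.tail h3, h4⟩

theorem IsHom.lift_thin {B C : UAlgebra σ} [Finite B.carrier] (hB : B.Idempotent)
    {φ : B.carrier → C.carrier} (hφ : IsHom B C φ) (hs : Function.Surjective φ)
    {x : B.carrier} {y : C.carrier} (h : C.IsThinSLEdge (φ x) y) :
    ∃ y', φ y' = y ∧ B.IsThinSLEdge x y' := by
  obtain ⟨T, -, h2, h3, -⟩ := h
  obtain ⟨f, hf, hD⟩ := exists_push hB T
  obtain ⟨d, hd⟩ := hs y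
  refine ⟨f.eval B ![x, d], ?_, hf _ _⟩
  refine hD {z | φ z = y} (hφ.fiber_closed (hφ.idempotent hs hB) y) x ?_ d hd
  rintro e he
  change φ e = y at he
  constructor
  · change φ _ = y
    rw [hφ.eval2, he, h2]
  · change φ _ = y
    rw [hφ.eval2, he, h3]

theorem IsHom.lift_sReach {B C : UAlgebra σ} [Finite B.carrier] (hB : B.Idempotent)
    {φ : B.carrier → C.carrier} (hφ : IsHom B C φ) (hs : Function.Surjective φ)
    {x : B.carrier} {y : C.carrier} (h : C.sReach (φ x) y) :
    ∃ y', φ y' = y ∧ B.sReach x y' := by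
  induction h with
  | refl => exact ⟨x, rfl, .refl⟩
  | tail _ hstep ih =>
    obtain ⟨y1, rfl, h2⟩ := ih
    obtain ⟨y2, h3, h4⟩ := hφ.lift_thin hB hs hstep
    exact ⟨y2, h3, h2.tail h4⟩

theorem IsHom.isMaxElem {B C : UAlgebra σ} [Finite B.carrier] (hB : B.Idempotent)
    {φ : B.carrier → C.carrier} (hφ : IsHom B C φ) (hs : Function.Surjective φ)
    {a : B.carrier} (ha : B.IsMaxElem a) : C.IsMaxElem (φ a) := by
  intro b hb
  obtain ⟨b', rfl, hb'⟩ := hφ.lift_sReach hB hs hb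
  exact hφ.sReach (ha _ hb')

theorem exists_max_above (Q : UAlgebra σ) [Finite Q.carrier] (x : Q.carrier) :
    ∃ m, Q.IsMaxElem m ∧ Q.sReach x m := by
  let _ : Preorder Q.carrier :=
    { le := Q.sReach
      le_refl := fun _ => .refl
      le_trans := fun _ _ _ h h' => h.trans h' }
  obtain ⟨m, hxm, hm⟩ := (Set.toFinite (Set.univ : Set Q.carrier)).exists_le_maximal
    (Set.mem_univ x)
  exact ⟨m, fun b hb => hm.2 (Set.mem_univ b) hb, hxm⟩

theorem IsMaxElem.of_sReach {Q : UAlgebra σ} {a b : Q.carrier} (ha : Q.IsMaxElem a)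
    (h : Q.sReach a b) : Q.IsMaxElem b :=
  fun _ hc => (ha _ (h.trans hc)).trans h

end UAlgebra

namespace UAlgebra

variable {σ : Signature}

/-- A strengthening of thin affine edges which lifts along surjective homomorphisms. -/
def GoodAff (H : Term σ 3 → Prop) (h : Term σ 3) (Q : UAlgebra σ) (x y : Q.carrier) : Prop :=
  h.eval Q ![y, x, x] = y ∧ h.eval Q ![y, y, x] ≠ y ∧
    ∀ h', H h' → ∃ r : Term σ 2, r.eval Q ![x, h'.eval Q ![x, x, y]] = y

/-- A thin semilattice edge or a good affine pair. -/
def GStep (H : Term σ 3 → Prop) (h : Term σ 3) (Q : UAlgebra σ) (x y : Q.carrier) : Prop :=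
  Q.IsThinSLEdge x y ∨ GoodAff H h Q x y

/-- Reachability along `GStep`. -/
def GReach (H : Term σ 3 → Prop) (h : Term σ 3) (Q : UAlgebra σ) : Q.carrier → Q.carrier → Prop :=
  Relation.ReflTransGen (GStep H h Q)

/-- Every maximal element is reachable from everywhere. -/
def MaxReachable (H : Term σ 3 → Prop) (h : Term σ 3) (Q : UAlgebra σ) : Prop :=
  ∀ x a, Q.IsMaxElem a → GReach H h Q x a

/-- The trace on `Q` of `MaxReachable` for the proper subalgebras of `Q`. -/
def ProperReachable (H : Term σ 3 → Prop) (h : Term σ 3) (Q : UAlgebra σ) : Prop :=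
  ∀ D : Set Q.carrier, Q.IsClosed D → D ≠ Set.univ → ∀ w ∈ D, ∀ x ∈ D,
    ∃ m ∈ D, Q.sReach w m ∧ GReach H h Q x m

variable {H : Term σ 3 → Prop} {h : Term σ 3}

theorem sReach.gReach {Q : UAlgebra σ} {x y : Q.carrier} (hxy : Q.sReach x y) :
    GReach H h Q x y :=
  Relation.ReflTransGen.mono (fun _ _ => Or.inl) _ _ hxy

theorem IsHom.gStep {A B : UAlgebra σ} {φ : A.carrier → B.carrier} (hφ : IsHom A B φ)
    (hi : Function.Injective φ) {x y : A.carrier} (hxy : GStep H h A x y) :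
    GStep H h B (φ x) (φ y) := by
  rcases hxy with hxy | ⟨h1, h2, h3⟩
  · exact Or.inl (hφ.thin hxy)
  · refine Or.inr ⟨by rw [← hφ.eval3, h1], ?_, fun h' hh' => ?_⟩
    · rw [← hφ.eval3]
      exact fun h => h2 (hi h)
    · obtain ⟨r, hr⟩ := h3 h' hh'
      exact ⟨r, by rw [← hφ.eval3, ← hφ.eval2, hr]⟩

theorem IsHom.gReach {A B : UAlgebra σ} {φ : A.carrier → B.carrier} (hφ : IsHom A B φ)
    (hi : Function.Injective φ) {x y : A.carrier} (hxy : GReach H h A x y) :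
    GReach H h B (φ x) (φ y) :=
  Relation.ReflTransGen.lift φ (fun _ _ h => hφ.gStep hi h) _ _ hxy

theorem closureSet_pair_subset {Q : UAlgebra σ} {x y z : Q.carrier}
    (hz : z ∈ Q.ClosureSet {x, y}) : Q.ClosureSet {x, z} ⊆ Q.ClosureSet {x, y} := by
  apply ClosureSet_subset (Q.closureSet_isClosed _)
  rintro w (rfl | rfl)
  · exact Closure.base (by simp)
  · exact hz

theorem IsHom.lift_goodAff {B C : UAlgebra σ} [Finite B.carrier]
    {φ : B.carrier → C.carrier} (hφ : IsHom B C φ) (hs : Function.Surjective φ)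
    (hid : ∀ x y, h.eval B ![h.eval B ![x, y, y], y, y] = h.eval B ![x, y, y])
    {x : B.carrier} {y : C.carrier} (hxy : GoodAff H h C (φ x) y) :
    ∃ y', φ y' = y ∧ GoodAff H h B x y' := by
  obtain ⟨h1, h2, h3⟩ := hxy
  obtain ⟨y0, hy0, hmin⟩ := (Set.toFinite {z | φ z = y}).exists_minimalFor
    (fun z => B.ClosureSet {x, z}) _ (hs y)
  change φ y0 = y at hy0
  have hmem : ∀ u v : B.carrier, v ∈ B.ClosureSet {u, v} := fun u v => Closure.base (by simp)
  have hmem' : ∀ u v : B.carrier, u ∈ B.ClosureSet {u, v} := fun u v => Closure.base (by simp)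
  set y1 := h.eval B ![y0, x, x] with hy1
  have hφ1 : φ y1 = y := by rw [hy1, hφ.eval3, hy0, h1]
  refine ⟨y1, hφ1, hid _ _, ?_, fun h' hh' => ?_⟩
  · intro he
    apply h2
    rw [← hφ1, ← hφ.eval3, he]
  · obtain ⟨r, hr⟩ := h3 h' hh'
    rw [← mem_closureSet_pair]
    set g := h'.eval B ![x, x, y1] with hg
    set y2 := r.eval B ![x, g] with hy2
    have hφ2 : φ y2 = y := by rw [hy2, hφ.eval2, hg, hφ.eval3, hφ1, hr]
    have c1 : y1 ∈ B.ClosureSet {x, y0} :=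
      (B.closureSet_isClosed _).eval3 h (hmem _ _) (hmem' _ _) (hmem' _ _)
    have c2 : g ∈ B.ClosureSet {x, y1} :=
      (B.closureSet_isClosed _).eval3 h' (hmem' _ _) (hmem' _ _) (hmem _ _)
    have c3 : y2 ∈ B.ClosureSet {x, g} := (B.closureSet_isClosed _).eval2 r (hmem' _ _) (hmem _ _)
    have c4 : B.ClosureSet {x, y0} ⊆ B.ClosureSet {x, y2} :=
      hmin hφ2 ((closureSet_pair_subset c3).trans
        ((closureSet_pair_subset c2).trans (closureSet_pair_subset c1)))
    exact closureSet_pair_subset c3 (c4 c1)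

theorem IsHom.lift_gReach {B C : UAlgebra σ} [Finite B.carrier] (hB : B.Idempotent)
    {φ : B.carrier → C.carrier} (hφ : IsHom B C φ) (hs : Function.Surjective φ)
    (hid : ∀ x y, h.eval B ![h.eval B ![x, y, y], y, y] = h.eval B ![x, y, y])
    {x : B.carrier} {y : C.carrier} (hxy : GReach H h C (φ x) y) :
    ∃ y', φ y' = y ∧ GReach H h B x y' := by
  induction hxy with
  | refl => exact ⟨x, rfl, .refl⟩
  | tail _ hstep ih =>
    obtain ⟨y1, rfl, h2⟩ := ih
    rcases hstep with hstep | hstep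
    · obtain ⟨y2, h3, h4⟩ := hφ.lift_thin hB hs hstep
      exact ⟨y2, h3, h2.tail (Or.inl h4)⟩
    · obtain ⟨y2, h3, h4⟩ := hφ.lift_goodAff hs hid hstep
      exact ⟨y2, h3, h2.tail (Or.inr h4)⟩

theorem ProperReachable.gReach {Q : UAlgebra σ} (hQ : ProperReachable H h Q)
    {D : Set Q.carrier} (hD : Q.IsClosed D) (hne : D ≠ Set.univ) {x a : Q.carrier} (hx : x ∈ D)
    (ha : a ∈ D) (hmax : Q.IsMaxElem a) : GReach H h Q x a := by
  obtain ⟨m, -, h1, h2⟩ := hQ D hD hne a ha x hx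
  exact h2.trans (hmax _ h1).gReach

theorem properReachable_of_subalg {Q : UAlgebra σ} [Finite Q.carrier]
    (hsub : ∀ D (hD : Q.IsClosed D), D ≠ Set.univ → MaxReachable H h (Q.subalg D hD)) :
    ProperReachable H h Q := by
  intro D hD hne w hw x hx
  have : Finite (Q.subalg D hD).carrier := inferInstanceAs (Finite {x // x ∈ D})
  obtain ⟨m, hm, hwm⟩ := exists_max_above (Q.subalg D hD) ⟨w, hw⟩
  refine ⟨m.1, m.2, (subalg_val_isHom Q D hD).sReach hwm, ?_⟩
  exact (subalg_val_isHom Q D hD).gReach Subtype.val_injective (hsub D hD hne ⟨x, hx⟩ m hm)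

theorem maxReachable_of_quot {Q : UAlgebra σ} [Finite Q.carrier] (hQ : Q.Idempotent)
    (hid : ∀ x y, h.eval Q ![h.eval Q ![x, y, y], y, y] = h.eval Q ![x, y, y])
    (hp : ProperReachable H h Q) (θ : Congruence Q) (hθ : ¬ θ.IsFull)
    (hq : MaxReachable H h (Q.quot θ)) : MaxReachable H h Q := by
  intro x a ha
  set φ : Q.carrier → (Q.quot θ).carrier := Quotient.mk θ.toSetoid
  have hφ : IsHom Q (Q.quot θ) φ := quot_mk_isHom Q θ
  have hs : Function.Surjective φ := Quotient.mk_surjective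
  have hmax : (Q.quot θ).IsMaxElem (φ a) := hφ.isMaxElem hQ hs ha
  obtain ⟨a', ha', hr⟩ := hφ.lift_gReach hQ hs hid (hq (φ x) (φ a) hmax)
  refine hr.trans (hp.gReach (hφ.fiber_closed (hQ.quot θ) (φ a)) ?_ ha' rfl ha)
  intro hu
  apply hθ
  intro y z
  have hy : φ y = φ a := Set.eq_univ_iff_forall.mp hu y
  have hz : φ z = φ a := Set.eq_univ_iff_forall.mp hu z
  exact Quotient.exact (s := θ.toSetoid) (hy.trans hz.symm)

theorem maxReachable_induction (K : UAlgebra σ → Prop) (hfin : ∀ Q, K Q → Finite Q.carrier)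
    (hidem : ∀ Q, K Q → Q.Idempotent)
    (hid : ∀ Q : UAlgebra σ, K Q → ∀ x y,
      h.eval Q ![h.eval Q ![x, y, y], y, y] = h.eval Q ![x, y, y])
    (hsub : ∀ Q, K Q → ∀ D (hD : Q.IsClosed D), K (Q.subalg D hD))
    (hquot : ∀ Q, K Q → ∀ θ : Congruence Q, K (Q.quot θ))
    (hsimple : ∀ Q, K Q → Q.IsSimple → Nontrivial Q.carrier → ProperReachable H h Q →
      MaxReachable H h Q) :
    ∀ Q, K Q → MaxReachable H h Q := by
  intro Q
  induction hn : Nat.card Q.carrier using Nat.strong_induction_on generalizing Q with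
  | _ n ih =>
    subst hn
    intro hK
    have := hfin Q hK
    have hp : ProperReachable H h Q := by
      refine properReachable_of_subalg fun D hD hne => ?_
      obtain ⟨x, hx⟩ := (Set.ne_univ_iff_exists_notMem D).mp hne
      exact ih _ (Finite.card_subtype_lt hx) _ rfl (hsub Q hK D hD)
    by_cases hsim : Q.IsSimple
    · rcases subsingleton_or_nontrivial Q.carrier with hss | hnt
      · intro x a _
        rw [Subsingleton.elim x a]
        exact .refl
      · exact hsimple Q hK hsim hnt hp
    · simp only [IsSimple, not_forall, not_or] at hsim
      obtain ⟨θ, hne, hfull⟩ := hsim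
      refine maxReachable_of_quot (hidem Q hK) (hid Q hK) hp θ (fun h => hfull h)
        (ih _ ?_ _ rfl (hquot Q hK θ))
      by_contra hle
      have hinj := (Function.Surjective.bijective_of_nat_card_le
        (f := Quotient.mk θ.toSetoid) Quotient.mk_surjective (not_lt.mp hle)).1
      obtain ⟨x, y, hxy⟩ := hne
      exact hxy ⟨fun h => hinj (Quotient.sound h), fun h => h ▸ θ.refl _⟩

end UAlgebra

namespace UAlgebra

variable {σ : Signature}

/-- Mutual reachability along `GStep`. -/
def Mut (H : Term σ 3 → Prop) (h : Term σ 3) (Q : UAlgebra σ) (x y : Q.carrier) : Prop :=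
  GReach H h Q x y ∧ GReach H h Q y x

theorem Mut.symm {H : Term σ 3 → Prop} {h : Term σ 3} {Q : UAlgebra σ} {x y : Q.carrier}
    (hxy : Mut H h Q x y) : Mut H h Q y x := ⟨hxy.2, hxy.1⟩

theorem Mut.trans {H : Term σ 3 → Prop} {h : Term σ 3} {Q : UAlgebra σ} {x y z : Q.carrier}
    (hxy : Mut H h Q x y) (hyz : Mut H h Q y z) : Mut H h Q x z :=
  ⟨hxy.1.trans hyz.1, hyz.2.trans hxy.2⟩

theorem IsMaxElem.mut {H : Term σ 3 → Prop} {h : Term σ 3} {Q : UAlgebra σ} {x y : Q.carrier}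
    (hx : Q.IsMaxElem x) (hxy : Q.sReach x y) : Mut H h Q x y :=
  ⟨hxy.gReach, (hx _ hxy).gReach⟩

/-- A simple counterexample to `MaxReachable` all of whose proper subalgebras behave well. -/
structure Pathological (H : Term σ 3 → Prop) (h : Term σ 3) (Q : UAlgebra σ) : Prop where
  fin : Finite Q.carrier
  idem : Q.Idempotent
  simple : Q.IsSimple
  proper : ProperReachable H h Q
  noMaj : ∀ a b : Q.carrier, a ≠ b → Q.ClosureSet {a, b} = Set.univ →
    (¬ ∃ t : Term σ 2, IsSemilatticeOn (fun x y => t.eval Q ![x, y]) {a, b}) →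
    ¬ ∃ t : Term σ 3, IsMajorityOn (fun x y z => t.eval Q ![x, y, z]) {a, b}
  notSet : ¬ Q.IsSetAlgebra
  bad : ¬ MaxReachable H h Q

namespace Pathological

variable {H : Term σ 3 → Prop} {h : Term σ 3} {Q : UAlgebra σ} (P : Pathological H h Q)

include P

theorem exists_not_mut : ∃ a b, Q.IsMaxElem a ∧ Q.IsMaxElem b ∧ ¬ Mut H h Q a b := by
  have := P.fin
  have hb := P.bad
  simp only [MaxReachable, not_forall] at hb
  obtain ⟨x, a, ha, hxa⟩ := hb
  obtain ⟨m, hm, hxm⟩ := Q.exists_max_above x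
  exact ⟨m, a, hm, ha, fun hmut => hxa (hxm.gReach.trans hmut.1)⟩

theorem exists_not_mut_left (c : Q.carrier) : ∃ a, Q.IsMaxElem a ∧ ¬ Mut H h Q c a := by
  obtain ⟨a, b, ha, hb, hab⟩ := P.exists_not_mut
  by_contra hcon
  push Not at hcon
  exact hab ((hcon a ha).symm.trans (hcon b hb))

theorem mut_of_mem {D : Set Q.carrier} (hD : Q.IsClosed D) (hne : D ≠ Set.univ)
    {a b : Q.carrier} (ha : a ∈ D) (hb : b ∈ D) (hma : Q.IsMaxElem a) (hmb : Q.IsMaxElem b) :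
    Mut H h Q a b :=
  ⟨P.proper.gReach hD hne ha hb hmb, P.proper.gReach hD hne hb ha hma⟩

theorem eq_univ_of_not_mut {a b : Q.carrier} (hma : Q.IsMaxElem a) (hmb : Q.IsMaxElem b)
    (hab : ¬ Mut H h Q a b) {D : Set Q.carrier} (hD : Q.IsClosed D) (ha : a ∈ D) (hb : b ∈ D) :
    D = Set.univ := by
  by_contra hne
  exact hab (P.mut_of_mem hD hne ha hb hma hmb)

omit P in
theorem ne_of_not_mut {a b : Q.carrier} (hab : ¬ Mut H h Q a b) : a ≠ b := by
  rintro rfl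
  exact hab ⟨.refl, .refl⟩

theorem exists_term {a b : Q.carrier} (hma : Q.IsMaxElem a) (hmb : Q.IsMaxElem b)
    (hab : ¬ Mut H h Q a b) (x : Q.carrier) : ∃ t : Term σ 2, t.eval Q ![a, b] = x :=
  Set.eq_univ_iff_forall.mp (P.eq_univ_of_not_mut hma hmb hab (isClosed_range_eval Q ![a, b])
    ⟨.var 0, rfl⟩ ⟨.var 1, rfl⟩) x

theorem no_semilattice {a b : Q.carrier} (hma : Q.IsMaxElem a) (hmb : Q.IsMaxElem b)
    (hab : ¬ Mut H h Q a b) (t : Term σ 2) (ht : t.eval Q ![a, b] = t.eval Q ![b, a]) :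
    t.eval Q ![a, b] ≠ a ∧ t.eval Q ![a, b] ≠ b := by
  constructor
  · intro h1
    have : Q.IsThinSLEdge b a := ⟨t, P.idem.eval2 t b, ht ▸ h1, h1, P.idem.eval2 t a⟩
    exact hab (hmb.mut (.single this)).symm
  · intro h1
    have : Q.IsThinSLEdge a b := ⟨t, P.idem.eval2 t a, h1, ht ▸ h1, P.idem.eval2 t b⟩
    exact hab (hma.mut (.single this))

theorem no_majority {a b : Q.carrier} (hma : Q.IsMaxElem a) (hmb : Q.IsMaxElem b)
    (hab : ¬ Mut H h Q a b) (t : Term σ 3)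
    (ht : IsMajorityOn (fun x y z => t.eval Q ![x, y, z]) {a, b}) : False := by
  refine P.noMaj a b (ne_of_not_mut hab) (P.eq_univ_of_not_mut hma hmb hab (Q.closureSet_isClosed _)
    (Closure.base (by simp)) (Closure.base (by simp))) ?_ ⟨t, ht⟩
  rintro ⟨s, hs1, hs2, hs3⟩
  have haa := hs1 a (by simp)
  have hbb := hs1 b (by simp)
  have hcomm : s.eval Q ![a, b] = s.eval Q ![b, a] := hs2 a (by simp) b (by simp)
  have h1 := hs3 a (by simp) a (by simp) b (by simp)
  have h2 := hs3 a (by simp) b (by simp) b (by simp)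
  have h3 := hs3 b (by simp) a (by simp) a (by simp)
  have h4 := hs3 b (by simp) b (by simp) a (by simp)
  simp only [haa, hbb] at h1 h2 h3 h4
  have hac : Q.IsThinSLEdge a (s.eval Q ![a, b]) :=
    ⟨s, haa, h1, by rw [hcomm, ← h3], P.idem.eval2 _ _⟩
  have hbc : Q.IsThinSLEdge b (s.eval Q ![a, b]) :=
    ⟨s, hbb, by rw [hcomm, h4], h2.symm, P.idem.eval2 _ _⟩
  exact hab ((hma.mut (.single hac)).trans (hmb.mut (.single hbc)).symm)

/-- A tolerance relating only mutually reachable maximal elements is trivial. -/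
theorem eq_of_tolerance {T : Q.carrier → Q.carrier → Prop} (hT : Q.Compat T)
    (hrefl : ∀ x, T x x) (hsymm : ∀ x y, T x y → T y x)
    (hmut : ∀ x y, Q.IsMaxElem x → Q.IsMaxElem y → T x y → Mut H h Q x y) :
    ∀ x y, T x y → x = y := by
  have := P.fin
  let G : Set (Q.carrier → Q.carrier → Prop) := {T | Q.Compat T ∧ (∀ x, T x x) ∧
    (∀ x y, T x y → T y x) ∧ ∀ x y, Q.IsMaxElem x → Q.IsMaxElem y → T x y → Mut H h Q x y}
  obtain ⟨U, hTU, ⟨hU, hUr, hUs, hUm⟩, hmaxU⟩ := (Set.toFinite G).exists_le_maximal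
    (show T ∈ G from ⟨hT, hrefl, hsymm, hmut⟩)
  have htrans : ∀ x y z, U x y → U y z → U x z := by
    intro x y z hxy hyz
    refine hmaxU (y := fun x y => ∃ z, U x z ∧ U z y)
      ⟨hU.comp hU, fun x => ⟨x, hUr x, hUr x⟩, fun x y ⟨z, h1, h2⟩ => ⟨z, hUs _ _ h2, hUs _ _ h1⟩,
        ?_⟩ (fun x y hxy => ⟨x, hUr x, hxy⟩) _ _ ⟨y, hxy, hyz⟩
    rintro x y hx hy ⟨z, hxz, hzy⟩
    obtain ⟨z', hz', hs⟩ := Q.exists_max_above z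
    obtain ⟨y', hyy', hzy'⟩ := hU.lift_sReach P.idem (fun x => ⟨x, hUr x⟩) hzy hs
    obtain ⟨x', hxx', hzx'⟩ := hU.lift_sReach P.idem (fun x => ⟨x, hUr x⟩) (hUs _ _ hxz) hs
    have h1 := hUm _ _ hz' (hy.of_sReach hyy') hzy'
    have h2 := hUm _ _ hz' (hx.of_sReach hxx') hzx'
    exact (hx.mut hxx').trans (h2.symm.trans (h1.trans (hy.mut hyy').symm))
  let θ : Congruence Q := ⟨U, hUr, fun h => hUs _ _ h, fun h h' => htrans _ _ _ h h', hU⟩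
  rcases P.simple θ with hθ | hθ
  · exact fun x y hxy => (hθ x y).mp (hTU x y hxy)
  · obtain ⟨a, b, ha, hb, hab⟩ := P.exists_not_mut
    exact absurd (hUm a b ha hb (hθ a b)) hab

theorem full_fiber_or_left_unique {R : Q.carrier → Q.carrier → Prop} (hR : Q.Compat R)
    (hl : ∀ x, ∃ y, R x y) (hr : ∀ y, ∃ x, R x y) :
    (∃ y, Q.IsMaxElem y ∧ ∀ x, R x y) ∨ ∀ x x' y, R x y → R x' y → x = x' := by
  by_cases hfull : ∃ y, Q.IsMaxElem y ∧ ∀ x, R x y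
  · exact Or.inl hfull
  refine Or.inr fun x x' y hxy hxy' => ?_
  refine P.eq_of_tolerance (hR.comp hR.swap) (fun x => ?_) ?_ ?_ x x' ⟨y, hxy, hxy'⟩
  · obtain ⟨y, hy⟩ := hl x
    exact ⟨y, hy, hy⟩
  · rintro x y ⟨z, h1, h2⟩
    exact ⟨z, h2, h1⟩
  · rintro x x' hx hx' ⟨y, hxy, hxy'⟩
    have := P.fin
    obtain ⟨y', hy', hs⟩ := Q.exists_max_above y
    obtain ⟨x1, hx1, hr1⟩ := hR.swap.lift_sReach P.idem hr hxy hs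
    obtain ⟨x2, hx2, hr2⟩ := hR.swap.lift_sReach P.idem hr hxy' hs
    have hm := P.mut_of_mem (hR.swap.fiber P.idem y') (fun hu => hfull ⟨y', hy',
      fun x => Set.eq_univ_iff_forall.mp hu x⟩) hr1 hr2 (hx.of_sReach hx1) (hx'.of_sReach hx2)
    exact (hx.mut hx1).trans (hm.trans (hx'.mut hx2).symm)

theorem full_fiber_or_right_unique {R : Q.carrier → Q.carrier → Prop} (hR : Q.Compat R)
    (hl : ∀ x, ∃ y, R x y) (hr : ∀ y, ∃ x, R x y) :
    (∃ x, Q.IsMaxElem x ∧ ∀ y, R x y) ∨ ∀ x y y', R x y → R x y' → y = y' := by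
  rcases P.full_fiber_or_left_unique hR.swap hr hl with h1 | h1
  · exact Or.inl h1
  · exact Or.inr fun x y y' h2 h3 => h1 y y' x h2 h3

/-- Unless two maximal elements are mutually reachable, they either are the bounds of a compatible
partial order or generate the pair needed for a local Mal'tsev operation. -/
theorem exists_order_of_not_gen {a b : Q.carrier} (ha : Q.IsMaxElem a) (hb : Q.IsMaxElem b)
    (hab : ¬ Mut H h Q a b) (hgen : ¬ Q.Gen ![a, a, b] ![a, b, b] b a) :
    ∃ R : Q.carrier → Q.carrier → Prop, Q.Compat R ∧ (∀ x, R x x) ∧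
      (∀ x y z, R x y → R y z → R x z) ∧ (∀ x y, R x y → R y x → x = y) ∧
      (∀ x, R a x) ∧ ∀ x, R x b := by
  have := P.fin
  have huniv : ∀ {c d : Q.carrier}, Q.IsMaxElem c → Q.IsMaxElem d → ¬ Mut H h Q c d →
      ∀ {D : Set Q.carrier}, Q.IsClosed D → c ∈ D → d ∈ D → ∀ x, x ∈ D :=
    fun {_ _} hc hd hcd {_} hD h1 h2 x =>
      Set.eq_univ_iff_forall.mp (P.eq_univ_of_not_mut hc hd hcd hD h1 h2) x
  have hdiag : ∀ x, Q.Gen ![a, a, b] ![a, b, b] x x := fun x =>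
    huniv ha hb hab (D := {x | Q.Gen ![a, a, b] ![a, b, b] x x})
      (fun f u hu => Q.gen_compat _ _ f u u hu) (Q.gen_base ![a, a, b] ![a, b, b] 0)
      (Q.gen_base ![a, a, b] ![a, b, b] 2) x
  have hgab : Q.Gen ![a, a, b] ![a, b, b] a b := Q.gen_base ![a, a, b] ![a, b, b] 1
  let G : Set (Q.carrier → Q.carrier → Prop) := {R | Q.Compat R ∧ (∀ x, R x x) ∧ R a b ∧ ¬ R b a}
  obtain ⟨U, -, ⟨hU, hUr, hUab, hUba⟩, hmaxU⟩ := (Set.toFinite G).exists_le_maximal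
    (show Q.Gen ![a, a, b] ![a, b, b] ∈ G from ⟨Q.gen_compat _ _, hdiag, hgab, hgen⟩)
  have htot : ∀ x, ∃ y, U x y := fun x => ⟨x, hUr x⟩
  have htot' : ∀ x, ∃ y, U y x := fun x => ⟨x, hUr x⟩
  have hbot : ∀ x, U a x := huniv ha hb hab (hU.fiber P.idem a) (hUr a) hUab
  have htop : ∀ x, U x b := huniv ha hb hab (hU.swap.fiber P.idem b) hUab (hUr b)
  have htrans : ∀ x y z, U x y → U y z → U x z := by
    intro x y z hxy hyz
    refine hmaxU (y := fun x y => ∃ z, U x z ∧ U z y)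
      ⟨hU.comp hU, fun x => ⟨x, hUr x, hUr x⟩, ⟨a, hUr a, hUab⟩, ?_⟩
      (fun x y hxy => ⟨x, hUr x, hxy⟩) _ _ ⟨y, hxy, hyz⟩
    rintro ⟨w, hbw, hwa⟩
    obtain ⟨w', hw', hs⟩ := Q.exists_max_above w
    obtain ⟨a', haa', hwa'⟩ := hU.lift_sReach P.idem htot hwa hs
    obtain ⟨b', hbb', hwb'⟩ := hU.swap.lift_sReach P.idem htot' hbw hs
    have ha' := ha.of_sReach haa'
    have hb' := hb.of_sReach hbb'
    by_cases hm : Mut H h Q b' w'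
    · have hm' : ¬ Mut H h Q a' w' := fun hm' => hab
        ((ha.mut haa').trans (hm'.trans (hm.symm.trans (hb.mut hbb').symm)))
      have h1 : U b a' := huniv ha' hw' hm' (hU.swap.fiber P.idem a') (hUr a') hwa' b
      obtain ⟨b2, hb2, h2⟩ := hU.swap.lift_sReach P.idem htot' h1 (ha _ haa')
      have hm2 : ¬ Mut H h Q b2 a := fun hm2 => hab (hm2.symm.trans (hb.mut hb2).symm)
      exact hUba (huniv (hb.of_sReach hb2) ha hm2 (hU.swap.fiber P.idem a) h2 (hUr a) b)
    · have h1 : U b' a := huniv hb' hw' hm (hU.fiber P.idem b') (hUr b') hwb' a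
      obtain ⟨a2, ha2, h2⟩ := hU.lift_sReach P.idem htot h1 (hb _ hbb')
      have hm2 : ¬ Mut H h Q b a2 := fun hm2 => hab ((ha.mut ha2).trans hm2.symm)
      exact hUba (huniv hb (ha.of_sReach ha2) hm2 (hU.fiber P.idem b) (hUr b) h2 a)
  let θ : Congruence Q := ⟨fun x y => U x y ∧ U y x, fun x => ⟨hUr x, hUr x⟩, fun h => ⟨h.2, h.1⟩,
    fun h h' => ⟨htrans _ _ _ h.1 h'.1, htrans _ _ _ h'.2 h.2⟩,
    fun f u v huv => ⟨hU f u v fun j => (huv j).1, hU f v u fun j => (huv j).2⟩⟩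
  refine ⟨U, hU, hUr, htrans, fun x y hxy hyx => ?_, hbot, htop⟩
  rcases P.simple θ with hθ | hθ
  · exact (hθ x y).mp ⟨hxy, hyx⟩
  · exact absurd (hθ b a).1 hUba

end Pathological

end UAlgebra

namespace UAlgebra

variable {σ : Signature}

/-- A compatible partial order with bottom `z` and top `e`. -/
structure BoundedOrder (Q : UAlgebra σ) (R : Q.carrier → Q.carrier → Prop) (z e : Q.carrier) :
    Prop where
  compat : Q.Compat R
  refl : ∀ x, R x x
  trans : ∀ x y w, R x y → R y w → R x w
  antisymm : ∀ x y, R x y → R y x → x = y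
  bot : ∀ x, R z x
  top : ∀ x, R x e

namespace Pathological

variable {H : Term σ 3 → Prop} {h : Term σ 3} {Q : UAlgebra σ} (P : Pathological H h Q)

include P

theorem ne_swap {z e : Q.carrier} (hz : Q.IsMaxElem z) (he : Q.IsMaxElem e)
    (hze : ¬ Mut H h Q z e) (t : Term σ 2) {x y : Q.carrier} (hx : t.eval Q ![z, e] = x)
    (hy : t.eval Q ![e, z] = y) (hbit : x = z ∨ x = e) : x ≠ y := by
  rintro rfl
  have := P.no_semilattice hz he hze t (hx.trans hy.symm)
  rw [hx] at this
  exact hbit.elim this.1 this.2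

theorem false_of_bits {z e : Q.carrier} (hz : Q.IsMaxElem z) (he : Q.IsMaxElem e)
    (hze : ¬ Mut H h Q z e) (t : Term σ 3) (h1 : t.eval Q ![z, z, e] = z)
    (h2 : t.eval Q ![z, e, z] = z) (h3 : t.eval Q ![z, e, e] = e)
    (h4 : t.eval Q ![e, e, z] = z ∨ t.eval Q ![e, e, z] = e)
    (h5 : t.eval Q ![e, z, e] = z ∨ t.eval Q ![e, z, e] = e)
    (h6 : t.eval Q ![e, z, z] = z ∨ t.eval Q ![e, z, z] = e) : False := by
  have h4' : t.eval Q ![e, e, z] = e := h4.resolve_left fun hc =>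
    P.ne_swap hz he hze (t.comp3 (.var 0) (.var 0) (.var 1)) (x := z) (y := z)
      (by simpa using h1) (by simpa using hc) (Or.inl rfl) rfl
  have h5' : t.eval Q ![e, z, e] = e := h5.resolve_left fun hc =>
    P.ne_swap hz he hze (t.comp3 (.var 0) (.var 1) (.var 0)) (x := z) (y := z)
      (by simpa using h2) (by simpa using hc) (Or.inl rfl) rfl
  have h6' : t.eval Q ![e, z, z] = z := h6.resolve_right fun hc =>
    P.ne_swap hz he hze (t.comp3 (.var 0) (.var 1) (.var 1)) (x := e) (y := e)
      (by simpa using h3) (by simpa using hc) (Or.inr rfl) rfl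
  refine P.no_majority hz he hze t ?_
  rintro x (rfl | rfl) y (rfl | rfl)
  · exact ⟨P.idem.eval3 t _, P.idem.eval3 t _, P.idem.eval3 t _⟩
  · exact ⟨h1, h2, h6'⟩
  · exact ⟨h4', h5', h3⟩
  · exact ⟨P.idem.eval3 t _, P.idem.eval3 t _, P.idem.eval3 t _⟩

variable {R : Q.carrier → Q.carrier → Prop} {z e : Q.carrier}

theorem max_eq_or_eq (B : BoundedOrder Q R z e) (hz : Q.IsMaxElem z) (he : Q.IsMaxElem e)
    (hze : ¬ Mut H h Q z e) {m : Q.carrier} (hm : Q.IsMaxElem m) : m = z ∨ m = e := by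
  by_contra hcon
  push Not at hcon
  have h1 : Mut H h Q m e := P.mut_of_mem (B.compat.fiber P.idem m)
    (fun hu => hcon.1 (B.antisymm _ _ (Set.eq_univ_iff_forall.mp hu z) (B.bot m)))
    (B.refl m) (B.top m) hm he
  have h2 : Mut H h Q m z := P.mut_of_mem (B.compat.swap.fiber P.idem m)
    (fun hu => hcon.2 (B.antisymm _ _ (B.top m) (Set.eq_univ_iff_forall.mp hu e)))
    (B.refl m) (B.bot m) hm hz
  exact hze (h2.symm.trans h1)

theorem thin_eq_of_bit (B : BoundedOrder Q R z e) (hz : Q.IsMaxElem z) (he : Q.IsMaxElem e)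
    (hze : ¬ Mut H h Q z e) {x y : Q.carrier} (hx : x = z ∨ x = e) (hxy : Q.IsThinSLEdge x y) :
    y = x := by
  rcases hx with rfl | rfl
  · rcases P.max_eq_or_eq B hz he hze (hz.of_sReach (.single hxy)) with h1 | rfl
    · exact h1
    · exact absurd (hz.mut (.single hxy)) hze
  · rcases P.max_eq_or_eq B hz he hze (he.of_sReach (.single hxy)) with rfl | h1
    · exact absurd (he.mut (.single hxy)).symm hze
    · exact h1

theorem gStep_eq_of_bit (B : BoundedOrder Q R z e) (hz : Q.IsMaxElem z) (he : Q.IsMaxElem e)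
    (hze : ¬ Mut H h Q z e) {x y : Q.carrier} (hx : x = z ∨ x = e) (hxy : GStep H h Q x y) :
    y = x := by
  rcases hxy with hs | ⟨h1, h2, -⟩
  · exact P.thin_eq_of_bit B hz he hze hx hs
  · refine absurd ?_ h2
    rcases hx with rfl | rfl
    · refine B.antisymm _ _ ?_ ?_
      · have := B.compat.eval3 h (B.refl y) (B.refl y) (B.bot y)
        rwa [P.idem.eval3] at this
      · have := B.compat.eval3 h (B.refl y) (B.bot y) (B.refl x)
        rwa [h1] at this
    · refine B.antisymm _ _ ?_ ?_
      · have := B.compat.eval3 h (B.refl y) (B.top y) (B.refl x)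
        rwa [h1] at this
      · have := B.compat.eval3 h (B.refl y) (B.refl y) (B.top y)
        rwa [P.idem.eval3] at this

theorem gReach_eq_of_bit (B : BoundedOrder Q R z e) (hz : Q.IsMaxElem z) (he : Q.IsMaxElem e)
    (hze : ¬ Mut H h Q z e) {x y : Q.carrier} (hx : x = z ∨ x = e) (hxy : GReach H h Q x y) :
    y = x := by
  induction hxy with
  | refl => rfl
  | tail _ hs ih =>
    rw [ih] at hs
    exact P.gStep_eq_of_bit B hz he hze hx hs

theorem sReach_top (B : BoundedOrder Q R z e) (hz : Q.IsMaxElem z) (he : Q.IsMaxElem e)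
    (hze : ¬ Mut H h Q z e) {w : Q.carrier} (hw : w ≠ z) : Q.sReach w e := by
  obtain ⟨m, -, h1, h2⟩ := P.proper {x | R w x} (B.compat.fiber P.idem w)
    (fun hu => hw (B.antisymm _ _ (Set.eq_univ_iff_forall.mp hu z) (B.bot w)))
    w (B.refl w) e (B.top w)
  rwa [P.gReach_eq_of_bit B hz he hze (Or.inr rfl) h2] at h1

theorem sReach_bot (B : BoundedOrder Q R z e) (hz : Q.IsMaxElem z) (he : Q.IsMaxElem e)
    (hze : ¬ Mut H h Q z e) {w : Q.carrier} (hw : w ≠ e) : Q.sReach w z := by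
  obtain ⟨m, -, h1, h2⟩ := P.proper {x | R x w} (B.compat.swap.fiber P.idem w)
    (fun hu => hw (B.antisymm _ _ (B.top w) (Set.eq_univ_iff_forall.mp hu e)))
    w (B.refl w) z (B.bot w)
  rwa [P.gReach_eq_of_bit B hz he hze (Or.inl rfl) h2] at h1

/-- The value of a term at a nonconstant tuple of bounds can be moved along thin semilattice edges
without changing values that are already bounds. -/
theorem exists_term_move (B : BoundedOrder Q R z e) (hz : Q.IsMaxElem z) (he : Q.IsMaxElem e)
    (hze : ¬ Mut H h Q z e) {n : ℕ} (t : Term σ n) (b : Fin n → Q.carrier) {j k : Fin n}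
    (hj : b j = z) (hk : b k = e) {w : Q.carrier} (hw : Q.sReach (t.eval Q b) w) :
    ∃ t' : Term σ n, t'.eval Q b = w ∧
      ∀ c, (t.eval Q c = z ∨ t.eval Q c = e) → t'.eval Q c = t.eval Q c := by
  have := P.fin
  induction hw with
  | refl => exact ⟨t, rfl, fun _ _ => rfl⟩
  | @tail u v _ hs ih =>
    obtain ⟨t1, h1, h2⟩ := ih
    obtain ⟨f, hf, hfv⟩ := exists_push_thin P.idem hs
    obtain ⟨r, hr⟩ := P.exists_term hz he hze v
    refine ⟨f.comp2 t1 (r.comp2 (.var j) (.var k)), ?_, fun c hc => ?_⟩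
    · simp [h1, hj, hk, hr, hfv]
    · rw [← h2 c hc, Term.eval_comp2]
      rw [← h2 c hc] at hc
      exact P.thin_eq_of_bit B hz he hze hc (hf _ _)

theorem exists_term_bits (B : BoundedOrder Q R z e) (hz : Q.IsMaxElem z) (he : Q.IsMaxElem e)
    (hze : ¬ Mut H h Q z e) {n : ℕ} (t : Term σ n) :
    ∃ t' : Term σ n, (∀ b, (∀ i, b i = z ∨ b i = e) → t'.eval Q b = z ∨ t'.eval Q b = e) ∧
      ∀ c, (t.eval Q c = z ∨ t.eval Q c = e) → t'.eval Q c = t.eval Q c := by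
  classical
  have := P.fin
  have key : ∀ F : Finset (Fin n → Q.carrier), ∃ t' : Term σ n,
      (∀ b ∈ F, (∀ i, b i = z ∨ b i = e) → t'.eval Q b = z ∨ t'.eval Q b = e) ∧
      ∀ c, (t.eval Q c = z ∨ t.eval Q c = e) → t'.eval Q c = t.eval Q c := by
    intro F
    induction F using Finset.induction_on with
    | empty => exact ⟨t, by simp, fun _ _ => rfl⟩
    | insert b F _ ih =>
      obtain ⟨t1, h1, h2⟩ := ih
      by_cases hb : (∀ i, b i = z ∨ b i = e) ∧ t1.eval Q b ≠ z ∧ t1.eval Q b ≠ e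
      · obtain ⟨hb, hbz, hbe⟩ := hb
        have hj : ∃ j, b j = z := by
          by_contra hcon
          push Not at hcon
          have : b = fun _ => e := funext fun i => (hb i).resolve_left (hcon i)
          rw [this, P.idem.eval_const] at hbe
          exact hbe rfl
        have hk : ∃ k, b k = e := by
          by_contra hcon
          push Not at hcon
          have : b = fun _ => z := funext fun i => (hb i).resolve_right (hcon i)
          rw [this, P.idem.eval_const] at hbz
          exact hbz rfl
        obtain ⟨j, hj⟩ := hj
        obtain ⟨k, hk⟩ := hk
        obtain ⟨t2, h3, h4⟩ := P.exists_term_move B hz he hze t1 b hj hk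
          (P.sReach_bot B hz he hze hbe)
        refine ⟨t2, fun c hc hcb => ?_, fun c hc => ?_⟩
        · rcases Finset.mem_insert.mp hc with rfl | hc
          · exact Or.inl h3
          · have := h1 c hc hcb
            rwa [h4 c this]
        · rw [h4 c (by rwa [h2 c hc]), h2 c hc]
      · refine ⟨t1, fun c hc hcb => ?_, h2⟩
        rcases Finset.mem_insert.mp hc with rfl | hc
        · by_contra hcon
          push Not at hcon
          exact hb ⟨hcb, hcon⟩
        · exact h1 c hc hcb
  have : Fintype (Fin n → Q.carrier) := Fintype.ofFinite _
  obtain ⟨t', h1, h2⟩ := key Finset.univ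
  exact ⟨t', fun b => h1 b (Finset.mem_univ b), h2⟩

theorem false_of_order_of_ne (B : BoundedOrder Q R z e) (hz : Q.IsMaxElem z) (he : Q.IsMaxElem e)
    (hze : ¬ Mut H h Q z e) {w : Q.carrier} (hwz : w ≠ z) (hwe : w ≠ e) : False := by
  have := P.fin
  obtain ⟨v, hvz, hv⟩ : ∃ v, v ≠ z ∧ Q.IsThinSLEdge v z := by
    have hs : Q.sReach w z := P.sReach_bot B hz he hze hwe
    by_contra hcon
    push Not at hcon
    have : ∀ x, Q.sReach w x → x ≠ z := by
      intro x hx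
      induction hx with
      | refl => exact hwz
      | tail _ hstep ih =>
        rintro rfl
        exact hcon _ ih hstep
    exact this z hs rfl
  have hzne : z ≠ e := ne_of_not_mut hze
  have hve : v ≠ e := by
    rintro rfl
    exact hzne (P.thin_eq_of_bit B hz he hze (Or.inr rfl) hv)
  obtain ⟨f, hf, hfv⟩ := exists_push_thin P.idem hv
  obtain ⟨s, hs⟩ := P.exists_term hz he hze v
  have hfz : ∀ y, f.eval Q ![z, y] = z := fun y =>
    P.thin_eq_of_bit B hz he hze (Or.inl rfl) (hf z y)
  let u : Term σ 3 := f.comp2 (s.comp2 (.var 0) (.var 1)) (.var 2)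
  have h010 : u.eval Q ![z, e, z] = z := by simp [u, hs, hfv]
  have h001 : u.eval Q ![z, z, e] = z := by simp [u, P.idem.eval2, hfz]
  have h011 : u.eval Q ![z, e, e] ≠ z := by
    intro hc
    have h1 : f.eval Q ![v, e] = z := by simpa [u, hs] using hc
    have h2 := B.compat.eval2 f (B.refl v) (B.top v)
    rw [P.idem.eval2, h1] at h2
    exact hvz (B.antisymm _ _ h2 (B.bot v))
  obtain ⟨t1, h1, h2⟩ := P.exists_term_move B hz he hze u ![z, e, e] (j := 0) (k := 1) rfl rfl
    (P.sReach_top B hz he hze h011)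
  obtain ⟨t2, h3, h4⟩ := P.exists_term_bits B hz he hze t1
  have hbits : ∀ x y w : Q.carrier, (x = z ∨ x = e) → (y = z ∨ y = e) → (w = z ∨ w = e) →
      t2.eval Q ![x, y, w] = z ∨ t2.eval Q ![x, y, w] = e := by
    intro x y w hx hy hw
    refine h3 _ fun i => ?_
    fin_cases i <;> assumption
  have g010 : t1.eval Q ![z, e, z] = z := by rw [h2 _ (Or.inl h010), h010]
  have g001 : t1.eval Q ![z, z, e] = z := by rw [h2 _ (Or.inl h001), h001]
  refine P.false_of_bits hz he hze t2 ?_ ?_ ?_ (hbits _ _ _ (Or.inr rfl) (Or.inr rfl) (Or.inl rfl))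
    (hbits _ _ _ (Or.inr rfl) (Or.inl rfl) (Or.inr rfl))
    (hbits _ _ _ (Or.inr rfl) (Or.inl rfl) (Or.inl rfl))
  · rw [h4 _ (Or.inl g001), g001]
  · rw [h4 _ (Or.inl g010), g010]
  · rw [h4 _ (Or.inr h1), h1]

theorem false_of_order_of_bits (B : BoundedOrder Q R z e) (hz : Q.IsMaxElem z)
    (he : Q.IsMaxElem e) (hze : ¬ Mut H h Q z e) (hall : ∀ x : Q.carrier, x = z ∨ x = e) :
    False := by
  classical
  have hne : z ≠ e := ne_of_not_mut hze
  apply P.notSet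
  intro n t
  let ind : Set (Fin n) → Fin n → Q.carrier := fun I i => if i ∈ I then e else z
  let F : Set (Set (Fin n)) := {I | t.eval Q (ind I) = e}
  have hmono : ∀ I J, I ⊆ J → I ∈ F → J ∈ F := by
    intro I J hIJ hI
    have h1 : R (t.eval Q (ind I)) (t.eval Q (ind J)) := by
      refine B.compat.eval t _ _ fun i => ?_
      by_cases hi : i ∈ I
      · simp [ind, hi, hIJ hi, B.refl]
      · simp [ind, hi, B.bot]
    rw [show t.eval Q (ind I) = e from hI] at h1
    exact B.antisymm _ _ (B.top _) h1
  have hnotF : ∀ I, I ∉ F → t.eval Q (ind I) = z := fun I hI => (hall _).resolve_right hI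
  have hcompl : ∀ I, I ∈ F ↔ Iᶜ ∉ F := by
    intro I
    let s : Term σ 2 := t.subst fun i => if i ∈ I then .var 0 else .var 1
    have h1 : ∀ x y : Q.carrier, s.eval Q ![x, y] = t.eval Q fun i => if i ∈ I then x else y := by
      intro x y
      simp only [s, Term.eval_subst]
      congr 1
      funext i
      split_ifs <;> rfl
    have h2 : s.eval Q ![e, z] = t.eval Q (ind I) := h1 e z
    have h3 : s.eval Q ![z, e] = t.eval Q (ind Iᶜ) := by
      rw [h1]
      congr 1
      funext i
      by_cases hi : i ∈ I <;> simp [ind, hi]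
    have h4 := P.ne_swap hz he hze s h3 h2 (hall _)
    constructor
    · intro hI hI'
      exact h4 (Eq.trans (show _ = e from hI') (show e = _ from hI.symm))
    · intro hI
      by_contra hI'
      exact h4 ((hnotF _ hI).trans (hnotF _ hI').symm)
  have hinter : ∀ I ∈ F, ∀ J ∈ F, I ∩ J ∈ F := by
    intro I hI J hJ
    by_contra hIJ
    let m : Term σ 3 := t.subst fun i =>
      if i ∈ I ∩ J then .var 0 else if i ∈ I then .var 1 else .var 2
    have hm : ∀ x y w : Q.carrier, m.eval Q ![x, y, w] =
        t.eval Q fun i => if i ∈ I ∩ J then x else if i ∈ I then y else w := by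
      intro x y w
      simp only [m, Term.eval_subst]
      congr 1
      funext i
      split_ifs <;> rfl
    have h1 : m.eval Q ![z, z, e] = z := by
      refine Eq.trans ?_ (hnotF Iᶜ ((hcompl I).mp hI))
      rw [hm]
      congr 1
      funext i
      by_cases hi : i ∈ I <;> simp [ind, hi]
    have h2 : m.eval Q ![e, z, e] = e := by
      have : J ⊆ (I ∩ J) ∪ Iᶜ := by
        intro i hi
        by_cases hi' : i ∈ I <;> simp [hi, hi']
      refine Eq.trans ?_ (hmono _ _ this hJ)
      rw [hm]
      congr 1
      funext i
      by_cases hi : i ∈ I <;> by_cases hi' : i ∈ J <;> simp [ind, hi, hi']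
    have h3 : m.eval Q ![e, z, z] = z := by
      refine Eq.trans ?_ (hnotF _ hIJ)
      rw [hm]
      congr 1
      funext i
      by_cases hi : i ∈ I <;> by_cases hi' : i ∈ J <;> simp [ind, hi, hi']
    refine P.false_of_bits hz he hze m h1 ?_ ?_ (hall _) (hall _) (hall _)
    · refine (hall _).resolve_right fun hc => P.ne_swap hz he hze
        (m.comp3 (.var 0) (.var 1) (.var 0)) (x := e) (y := e)
        (by simpa using hc) (by simpa using h2) (Or.inr rfl) rfl
    · refine (hall _).resolve_left fun hc => P.ne_swap hz he hze
        (m.comp3 (.var 0) (.var 1) (.var 1)) (x := z) (y := z)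
        (by simpa using hc) (by simpa using h3) (Or.inl rfl) rfl
  have huniv : Set.univ ∈ F := by
    change t.eval Q _ = e
    rw [show ind Set.univ = fun _ => e by funext i; simp [ind], P.idem.eval_const]
  obtain ⟨I, -, hI, hmin⟩ := (Set.toFinite F).exists_le_minimal huniv
  have hne' : I.Nonempty := by
    by_contra hcon
    rw [Set.not_nonempty_iff_eq_empty] at hcon
    subst hcon
    have : t.eval Q (ind ∅) = e := hI
    rw [show ind ∅ = fun _ => z by funext i; simp [ind], P.idem.eval_const] at this
    exact hne this
  obtain ⟨i, hi⟩ := hne'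
  have hle : ∀ J ∈ F, i ∈ J := fun J hJ =>
    (hmin (hinter I hI J hJ) Set.inter_subset_left hi).2
  refine ⟨i, fun x => ?_⟩
  have hx : x = ind {j | x j = e} := by
    funext j
    rcases hall (x j) with hj | hj <;> simp [ind, hj, hne]
  by_cases hJ : {j | x j = e} ∈ F
  · have : x i = e := hle _ hJ
    rw [this]
    conv_lhs => rw [hx]
    exact hJ
  · have h1 := hle _ (by_contra fun hc => hJ ((hcompl _).mpr hc) :)
    have h2 : x i = z := (hall _).resolve_right h1
    rw [h2]
    conv_lhs => rw [hx]
    exact hnotF _ hJ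

theorem gen_of_not_mut {a b : Q.carrier} (ha : Q.IsMaxElem a) (hb : Q.IsMaxElem b)
    (hab : ¬ Mut H h Q a b) : ∃ p : Term σ 3, p.eval Q ![a, a, b] = b ∧ p.eval Q ![a, b, b] = a := by
  by_contra hgen
  obtain ⟨R, h1, h2, h3, h4, h5, h6⟩ := P.exists_order_of_not_gen ha hb hab hgen
  have B : BoundedOrder Q R a b := ⟨h1, h2, h3, h4, h5, h6⟩
  by_cases hall : ∀ x : Q.carrier, x = a ∨ x = b
  · exact P.false_of_order_of_bits B ha hb hab hall
  · push Not at hall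
    obtain ⟨w, hwa, hwb⟩ := hall
    exact P.false_of_order_of_ne B ha hb hab hwa hwb

end Pathological

end UAlgebra

namespace UAlgebra

variable {σ : Signature}

/-- A ternary relation preserved by all term operations. -/
def Compat3 (Q : UAlgebra σ) (R : Q.carrier → Q.carrier → Q.carrier → Prop) : Prop :=
  ∀ (n : ℕ) (t : Term σ n) (u v w : Fin n → Q.carrier), (∀ j, R (u j) (v j) (w j)) →
    R (t.eval Q u) (t.eval Q v) (t.eval Q w)

namespace Compat3

variable {Q : UAlgebra σ} {R : Q.carrier → Q.carrier → Q.carrier → Prop}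

theorem eval2 (hR : Q.Compat3 R) (t : Term σ 2) {x y x' y' x'' y'' : Q.carrier}
    (hx : R x x' x'') (hy : R y y' y'') :
    R (t.eval Q ![x, y]) (t.eval Q ![x', y']) (t.eval Q ![x'', y'']) :=
  hR 2 t _ _ _ fun i => by fin_cases i <;> assumption

theorem eval3 (hR : Q.Compat3 R) (t : Term σ 3) {x y z x' y' z' x'' y'' z'' : Q.carrier}
    (hx : R x x' x'') (hy : R y y' y'') (hz : R z z' z'') :
    R (t.eval Q ![x, y, z]) (t.eval Q ![x', y', z']) (t.eval Q ![x'', y'', z'']) :=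
  hR 3 t _ _ _ fun i => by fin_cases i <;> assumption

theorem fiber (hR : Q.Compat3 R) (hQ : Q.Idempotent) (x : Q.carrier) : Q.Compat (R x) := by
  intro f u v huv
  have := hR _ (Term.app f Term.var) (fun _ => x) u v huv
  rwa [hQ.eval_const] at this

theorem swap (hR : Q.Compat3 R) : Q.Compat3 fun x y z => R y x z :=
  fun n t u v w h => hR n t v u w h

end Compat3

namespace Pathological

variable {H : Term σ 3 → Prop} {h : Term σ 3} {Q : UAlgebra σ} (P : Pathological H h Q)

include P

theorem exists_related {a b : Q.carrier} (ha : Q.IsMaxElem a) (hb : Q.IsMaxElem b)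
    (hab : ¬ Mut H h Q a b) {R : Q.carrier → Q.carrier → Prop} (hR : Q.Compat R)
    {a' b' : Q.carrier} (h1 : R a a') (h2 : R b b') (x : Q.carrier) : ∃ y, R x y := by
  obtain ⟨t, rfl⟩ := P.exists_term ha hb hab x
  exact ⟨_, hR.eval2 t h1 h2⟩

theorem all_related {a b : Q.carrier} (ha : Q.IsMaxElem a) (hb : Q.IsMaxElem b)
    (hab : ¬ Mut H h Q a b) {R : Q.carrier → Q.carrier → Prop} (hR : Q.Compat R)
    {x : Q.carrier} (h1 : R x a) (h2 : R x b) (y : Q.carrier) : R x y :=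
  Set.eq_univ_iff_forall.mp (P.eq_univ_of_not_mut ha hb hab (hR.fiber P.idem x) h1 h2) y

theorem gen_diag {c a : Q.carrier} (hc : Q.IsMaxElem c) (ha : Q.IsMaxElem a)
    (hca : ¬ Mut H h Q c a) : Q.Gen ![c, c, a] ![c, a, c] a a := by
  have := P.fin
  by_contra hcon
  let G : Set (Q.carrier × Q.carrier) := {p | Q.IsMaxElem p.1 ∧ Q.IsMaxElem p.2 ∧
    ¬ Mut H h Q p.1 p.2 ∧ ¬ Q.Gen ![p.1, p.1, p.2] ![p.1, p.2, p.1] p.2 p.2}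
  obtain ⟨⟨c, a⟩, ⟨hc, ha, hca, hcon⟩, hmin⟩ := (Set.toFinite G).exists_minimalFor
    (fun p => Q.Gen ![p.1, p.1, p.2] ![p.1, p.2, p.1]) _ ⟨(c, a), hc, ha, hca, hcon⟩
  simp only at hc ha hca hcon
  set N := Q.Gen ![c, c, a] ![c, a, c] with hN
  have hNc : Q.Compat N := Q.gen_compat _ _
  have hcc : N c c := Q.gen_base ![c, c, a] ![c, a, c] 0
  have hNca : N c a := Q.gen_base ![c, c, a] ![c, a, c] 1
  have hNac : N a c := Q.gen_base ![c, c, a] ![c, a, c] 2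
  set S := Q.Gen ![a, c] ![c, a] with hS
  have hSc : Q.Compat S := Q.gen_compat _ _
  have hSac : S a c := Q.gen_base ![a, c] ![c, a] 0
  have hSca : S c a := Q.gen_base ![a, c] ![c, a] 1
  have hSN : ∀ x y, S x y → N x y := fun x y hxy =>
    Gen.least hNc (fun i => by fin_cases i <;> assumption) hxy
  have hSs : ∀ x y, S x y → S y x := fun x y hxy =>
    Gen.least hSc.swap (fun i => by fin_cases i <;> assumption) hxy
  have hSt := P.exists_related hc ha hca hSc hSca hSac
  rcases P.full_fiber_or_left_unique hSc hSt (fun y => (hSt y).imp fun x hx => hSs _ _ hx) with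
    ⟨d, hd, hfull⟩ | huniq
  · have hcd : Mut H h Q c d := by
      refine P.mut_of_mem (hNc.all_fiber P.idem Set.univ) (fun hu => hcon ?_)
        (fun y _ => P.all_related hc ha hca hNc hcc hNca y)
        (fun y _ => hSN _ _ (hSs _ _ (hfull y))) hc hd
      exact Set.eq_univ_iff_forall.mp hu a a (Set.mem_univ a)
    have hda : ¬ Mut H h Q d a := fun hda => hca (hcd.trans hda)
    have hle : ∀ x y, Q.Gen ![d, d, a] ![d, a, d] x y → S x y := by
      refine fun x y hxy => Gen.least hSc (fun i => ?_) hxy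
      fin_cases i
      · exact hfull d
      · exact hSs _ _ (hfull a)
      · exact hfull a
    have hmem : (d, a) ∈ G := ⟨hd, ha, hda, fun hc => hcon (hSN _ _ (hle _ _ hc))⟩
    obtain ⟨t, ht1, ht2⟩ := hle _ _ (hmin hmem (fun x y hxy => hSN x y (hle x y hxy)) c c hcc)
    exact (P.no_semilattice ha hc (fun hm => hca hm.symm) t (ht1.trans ht2.symm)).2 ht1
  · obtain ⟨p, hp1, hp2⟩ := P.gen_of_not_mut hc ha hca
    have h1 := hSc.eval3 p hSac hSca hSca
    rw [hp2] at h1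
    have h2 := huniq _ _ _ h1 hSac
    have h3 := hNc.eval3 p hNac hcc hNca
    rw [h2, hp1] at h3
    exact hcon h3

theorem full_of_full_fiber {R : Q.carrier → Q.carrier → Prop} (hR : Q.Compat R)
    (hl : ∀ x, ∃ y, R x y) {c : Q.carrier} (hc : Q.IsMaxElem c) (hcR : ∀ y, R c y) :
    ∀ x y, R x y := by
  have := P.fin
  by_contra hcon
  have hC : {x | ∀ y ∈ Set.univ, R x y} ≠ Set.univ := fun hu => hcon fun x y =>
    Set.eq_univ_iff_forall.mp hu x y (Set.mem_univ y)
  obtain ⟨a, ha, hca⟩ := P.exists_not_mut_left c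
  have haC : ¬ ∀ y, R a y := fun haC => hca (P.mut_of_mem (hR.all_fiber P.idem Set.univ) hC
    (fun y _ => hcR y) (fun y _ => haC y) hc ha)
  obtain ⟨t, ht1, ht2⟩ := P.gen_diag hc ha hca
  obtain ⟨f, hf, hfD⟩ := exists_push P.idem (t.comp3 (.var 1) (.var 1) (.var 0) : Term σ 2)
  obtain ⟨d, hd⟩ := hl a
  have hmem : ∀ x, f.eval Q ![x, d] ∈ {y | R a y} := by
    refine fun x => hfD _ (hR.fiber P.idem a) x (fun d hd => ⟨?_, ?_⟩) d hd
    · have := hR.eval3 t (hcR d) hd (hcR x)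
      rw [ht2] at this
      simpa using this
    · have := hR.eval3 t (hcR x) (hcR x) hd
      rw [ht1] at this
      simpa using this
  obtain ⟨u, v, hu, hv, huv⟩ := P.exists_not_mut
  have hm := P.mut_of_mem (hR.fiber P.idem a)
    (fun hu => haC fun y => Set.eq_univ_iff_forall.mp hu y) (hmem u) (hmem v)
    (hu.of_sReach (.single (hf u d))) (hv.of_sReach (.single (hf v d)))
  exact huv ((hu.mut (.single (hf u d))).trans (hm.trans (hv.mut (.single (hf v d))).symm))

/-- A subdirect binary relation is full or the graph of a bijection. -/
theorem full_or_graph {R : Q.carrier → Q.carrier → Prop} (hR : Q.Compat R)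
    (hl : ∀ x, ∃ y, R x y) (hr : ∀ y, ∃ x, R x y) :
    (∀ x y, R x y) ∨ ((∀ x x' y, R x y → R x' y → x = x') ∧
      ∀ x y y', R x y → R x y' → y = y') := by
  rcases P.full_fiber_or_left_unique hR hl hr with ⟨y, hy, hyR⟩ | h1
  · exact Or.inl fun x y' => P.full_of_full_fiber hR.swap hr hy hyR y' x
  rcases P.full_fiber_or_right_unique hR hl hr with ⟨x, hx, hxR⟩ | h2
  · exact Or.inl (P.full_of_full_fiber hR hl hx hxR)
  · exact Or.inr ⟨h1, h2⟩

/-- A ternary relation with full binary projections is full or the graph of a quasigroup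
operation (two of the three cancellation laws). -/
theorem full3_or_unique {R : Q.carrier → Q.carrier → Q.carrier → Prop} (hR : Q.Compat3 R)
    (h12 : ∀ x y, ∃ z, R x y z) (h13 : ∀ x z, ∃ y, R x y z) :
    (∀ x y z, R x y z) ∨ ∀ x, (∀ y y' z, R x y z → R x y' z → y = y') ∧
      ∀ y z z', R x y z → R x y z' → z = z' := by
  have := P.fin
  have hdich : ∀ x, (∀ y z, R x y z) ∨ ((∀ y y' z, R x y z → R x y' z → y = y') ∧
      ∀ y z z', R x y z → R x y z' → z = z') := fun x =>
    P.full_or_graph (hR.fiber P.idem x) (h12 x) (h13 x)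
  by_contra hcon
  rw [not_or] at hcon
  obtain ⟨hnf, hng⟩ := hcon
  obtain ⟨c0, hc0⟩ : ∃ c, ∀ y z, R c y z := by
    by_contra hcon
    push Not at hcon
    exact hng fun x => (hdich x).resolve_left fun hx => by
      obtain ⟨y, z, hyz⟩ := hcon x
      exact hyz (hx y z)
  have hup : ∀ c c', Q.IsThinSLEdge c c' → (∀ y z, R c y z) → ∀ y z, R c' y z := by
    intro c c' hcc' hc
    refine (hdich c').resolve_right fun hg => ?_
    obtain ⟨f, hf, hfc⟩ := exists_push_thin P.idem hcc'
    obtain ⟨z1, z2, hz1, hz2, hz⟩ := P.exists_not_mut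
    obtain ⟨z0, hz0⟩ := h12 c' c
    have h1 := hR.eval2 f (hc c z1) hz0
    have h2 := hR.eval2 f (hc c z2) hz0
    rw [hfc] at h1 h2
    have h3 := hg.2 _ _ _ h1 h2
    have h4 := hz1.mut (H := H) (h := h) (.single (hf z1 z0))
    have h5 := hz2.mut (H := H) (h := h) (.single (hf z2 z0))
    rw [h3] at h4
    exact hz (h4.trans h5.symm)
  obtain ⟨c, hc, hs⟩ := Q.exists_max_above c0
  have hcR : ∀ y z, R c y z := by
    clear hc
    induction hs with
    | refl => exact hc0
    | tail _ hstep ih => exact hup _ _ hstep ih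
  obtain ⟨a, ha, hca⟩ := P.exists_not_mut_left c
  have haR : ¬ ∀ y z, R a y z := by
    intro haR
    apply hnf
    intro x y z
    have hcl : Q.IsClosed {x | R x y z} := by
      intro f v hv
      have := hR _ (Term.app f Term.var) v (fun _ => y) (fun _ => z) hv
      rwa [P.idem.eval_const, P.idem.eval_const] at this
    exact Set.eq_univ_iff_forall.mp
      (P.eq_univ_of_not_mut hc ha hca hcl (hcR y z) (haR y z)) x
  have hg := (hdich a).resolve_left haR
  obtain ⟨t, ht1, ht2⟩ := P.gen_diag hc ha hca
  have e1 : ∀ w z, t.eval Q ![w, w, z] = z := by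
    intro w z
    obtain ⟨y, hy⟩ := h13 a z
    have h1 := hR.eval3 t (hcR y w) (hcR y w) hy
    rw [ht1, P.idem.eval3] at h1
    exact hg.2 _ _ _ h1 hy
  have e2 : ∀ w z, t.eval Q ![z, z, w] = z := by
    intro w z
    obtain ⟨y, hy⟩ := h13 a z
    have h1 := hR.eval3 t (hcR y z) hy (hcR y w)
    rw [ht2, P.idem.eval3] at h1
    exact hg.2 _ _ _ h1 hy
  exact ne_of_not_mut hca ((e2 a c).symm.trans (e1 c a))

/-- A quasigroup operation commuting with all term operations. -/
theorem exists_quasigroup : ∃ q : Q.carrier → Q.carrier → Q.carrier,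
    (∀ (n : ℕ) (t : Term σ n) (u v : Fin n → Q.carrier),
      q (t.eval Q u) (t.eval Q v) = t.eval Q fun i => q (u i) (v i)) ∧
    (∀ x, Function.Bijective (q x)) ∧ ∀ y, Function.Bijective fun x => q x y := by
  have := P.fin
  obtain ⟨a, b, ha, hb, hab⟩ := P.exists_not_mut
  have hfull : ∀ x y, ∃ t : Term σ 3, t.eval Q ![a, a, b] = x ∧ t.eval Q ![a, b, a] = y := by
    have hN : Q.Compat (Q.Gen ![a, a, b] ![a, b, a]) := Q.gen_compat _ _
    have h1 : ∀ y, Q.Gen ![a, a, b] ![a, b, a] a y := P.all_related ha hb hab hN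
      (Q.gen_base ![a, a, b] ![a, b, a] 0) (Q.gen_base ![a, a, b] ![a, b, a] 1)
    have h2 : ∀ y, Q.Gen ![a, a, b] ![a, b, a] b y := P.all_related ha hb hab hN
      (Q.gen_base ![a, a, b] ![a, b, a] 2) (P.gen_diag ha hb hab)
    exact fun x y => P.all_related ha hb hab hN.swap (h1 y) (h2 y) x
  let M : Q.carrier → Q.carrier → Q.carrier → Prop := fun x y z => ∃ t : Term σ 3,
    t.eval Q ![a, a, b] = x ∧ t.eval Q ![a, b, a] = y ∧ t.eval Q ![b, a, a] = z
  have hM : Q.Compat3 M := by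
    intro n t u v w huvw
    choose s hs using huvw
    refine ⟨t.subst s, ?_, ?_, ?_⟩ <;> rw [Term.eval_subst] <;> congr 1 <;> funext i
    · exact (hs i).1
    · exact (hs i).2.1
    · exact (hs i).2.2
  have h12 : ∀ x y, ∃ z, M x y z := fun x y => by
    obtain ⟨t, h1, h2⟩ := hfull x y
    exact ⟨_, t, h1, h2, rfl⟩
  have h13 : ∀ x z, ∃ y, M x y z := fun x z => by
    obtain ⟨t, h1, h2⟩ := hfull x z
    exact ⟨_, t.comp3 (.var 1) (.var 0) (.var 2), by simpa using h1, rfl, by simpa using h2⟩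
  have h23 : ∀ y z, ∃ x, M x y z := fun y z => by
    obtain ⟨t, h1, h2⟩ := hfull y z
    exact ⟨_, t.comp3 (.var 2) (.var 0) (.var 1), rfl, by simpa using h1, by simpa using h2⟩
  have hnf : ¬ ∀ x y z, M x y z := by
    intro hf
    obtain ⟨t, h1, h2, h3⟩ := hf a a a
    have hS : Q.Compat (Q.Gen ![a, b] ![b, a]) := Q.gen_compat _ _
    have hSab : Q.Gen ![a, b] ![b, a] a b := Q.gen_base ![a, b] ![b, a] 0
    have hSba : Q.Gen ![a, b] ![b, a] b a := Q.gen_base ![a, b] ![b, a] 1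
    rcases P.full_or_graph hS (P.exists_related ha hb hab hS hSab hSba)
      (P.exists_related ha hb hab hS.swap hSba hSab) with hSf | ⟨-, hSu⟩
    · obtain ⟨s, hs1, hs2⟩ := hSf a a
      exact (P.no_semilattice ha hb hab s (hs1.trans hs2.symm)).1 hs1
    · have g1 := hS.eval3 t hSab hSab hSba
      have g2 := hS.eval3 t hSab hSba hSab
      have g3 := hS.eval3 t hSba hSab hSab
      rw [h1] at g1
      rw [h2] at g2
      rw [h3] at g3
      have g1 := hSu _ _ _ g1 hSab
      have g2 := hSu _ _ _ g2 hSab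
      have g3 := hSu _ _ _ g3 hSab
      refine P.no_majority ha hb hab t ?_
      rintro x (rfl | rfl) y (rfl | rfl)
      · exact ⟨P.idem.eval3 t _, P.idem.eval3 t _, P.idem.eval3 t _⟩
      · exact ⟨h1, h2, h3⟩
      · exact ⟨g1, g2, g3⟩
      · exact ⟨P.idem.eval3 t _, P.idem.eval3 t _, P.idem.eval3 t _⟩
  have hu := (P.full3_or_unique hM h12 h13).resolve_left hnf
  have hu' := (P.full3_or_unique hM.swap (fun x y => h12 y x) (fun x z => h23 x z)).resolve_left
    fun hf => hnf fun x y z => hf y x z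
  choose q hq using h12
  refine ⟨q, fun n t u v => ?_, fun x => ⟨fun y y' hy => ?_, fun z => ?_⟩,
    fun y => ⟨fun x x' hx => ?_, fun z => ?_⟩⟩
  · exact (hu _).2 _ _ _ (hq _ _) (hM n t u v _ fun i => hq _ _)
  · exact (hu x).1 _ _ _ (hq x y) (hy ▸ hq x y')
  · obtain ⟨y, hy⟩ := h13 x z
    exact ⟨y, (hu x).2 _ _ _ (hq x y) hy⟩
  · have : q x y = q x' y := hx
    exact (hu' y).1 _ _ _ (hq x y) (this ▸ hq x' y)
  · obtain ⟨x, hx⟩ := h23 y z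
    exact ⟨x, (hu x).2 _ _ _ (hq x y) hx⟩

theorem closure_pair_eq_univ {a b : Q.carrier} (hab : a ≠ b) :
    Q.ClosureSet {a, b} = Set.univ := by
  have := P.fin
  obtain ⟨q, hq, hq1, hq2⟩ := P.exists_quasigroup
  have hhom : ∀ s, IsHom Q Q (q s) := by
    intro s f x
    have := hq _ (Term.app f Term.var) (fun _ => s) x
    rwa [P.idem.eval_const] at this
  have hmax : ∀ x, Q.IsMaxElem x := by
    intro x
    obtain ⟨m, -, hm, -⟩ := P.exists_not_mut
    obtain ⟨s, rfl⟩ := (hq2 m).2 x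
    exact (hhom s).isMaxElem P.idem (hq1 s).2 hm
  by_contra hne
  set D := Q.ClosureSet {a, b} with hD
  have hDc : Q.IsClosed D := Q.closureSet_isClosed _
  have haD : a ∈ D := Closure.base (by simp)
  have hbD : b ∈ D := Closure.base (by simp)
  have hT : ∀ x y, (∃ s, ∃ x' ∈ D, ∃ y' ∈ D, q s x' = x ∧ q s y' = y) → x = y := by
    refine P.eq_of_tolerance ?_ ?_ ?_ ?_
    · intro f u v huv
      choose s x hx y hy h1 h2 using huv
      refine ⟨Q.interp f s, Q.interp f x, hDc f _ hx, Q.interp f y, hDc f _ hy, ?_, ?_⟩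
      · rw [show u = fun j => q (s j) (x j) from funext fun j => (h1 j).symm]
        exact hq _ (Term.app f Term.var) s x
      · rw [show v = fun j => q (s j) (y j) from funext fun j => (h2 j).symm]
        exact hq _ (Term.app f Term.var) s y
    · intro x
      obtain ⟨s, hs⟩ := (hq2 a).2 x
      exact ⟨s, a, haD, a, haD, hs, hs⟩
    · rintro x y ⟨s, x', hx', y', hy', h1, h2⟩
      exact ⟨s, y', hy', x', hx', h2, h1⟩
    · rintro x y hx hy ⟨s, x', hx', y', hy', h1, h2⟩
      refine P.mut_of_mem (D := q s '' D) ?_ ?_ ⟨x', hx', h1⟩ ⟨y', hy', h2⟩ hx hy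
      · intro f u hu
        choose v hv hv' using hu
        refine ⟨Q.interp f v, hDc f _ hv, ?_⟩
        rw [hhom s]
        simp only [hv']
      · intro hu
        apply hne
        rw [Set.eq_univ_iff_forall] at hu ⊢
        intro w
        obtain ⟨w', hw', he⟩ := hu (q s w)
        exact (hq1 s).1 he ▸ hw'
  exact hab ((hq1 a).1 (hT _ _ ⟨a, a, haD, b, hbD, rfl, rfl⟩))

theorem exists_local_maltsev (a b c d : Q.carrier) :
    ∃ s : Term σ 3, s.eval Q ![a, b, b] = a ∧ s.eval Q ![c, c, d] = d := by
  by_cases hab : a = b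
  · subst hab
    exact ⟨.var 2, rfl, rfl⟩
  by_cases hcd : c = d
  · subst hcd
    exact ⟨.var 0, rfl, rfl⟩
  have hR : Q.Compat (Q.Gen ![a, b, b] ![c, c, d]) := Q.gen_compat _ _
  have h0 : Q.Gen ![a, b, b] ![c, c, d] a c := Q.gen_base ![a, b, b] ![c, c, d] 0
  have h1 : Q.Gen ![a, b, b] ![c, c, d] b c := Q.gen_base ![a, b, b] ![c, c, d] 1
  have h2 : Q.Gen ![a, b, b] ![c, c, d] b d := Q.gen_base ![a, b, b] ![c, c, d] 2
  have hl : ∀ x, ∃ y, Q.Gen ![a, b, b] ![c, c, d] x y := by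
    intro x
    obtain ⟨t, rfl⟩ := mem_closureSet_pair.mp
      (Set.eq_univ_iff_forall.mp (P.closure_pair_eq_univ hab) x)
    exact ⟨_, hR.eval2 t h0 h1⟩
  have hr : ∀ y, ∃ x, Q.Gen ![a, b, b] ![c, c, d] x y := by
    intro y
    obtain ⟨t, rfl⟩ := mem_closureSet_pair.mp
      (Set.eq_univ_iff_forall.mp (P.closure_pair_eq_univ hcd) y)
    exact ⟨_, hR.eval2 t h1 h2⟩
  rcases P.full_or_graph hR hl hr with hf | hg
  · exact hf a d
  · exact absurd (hg.1 _ _ _ h0 h1) hab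

end Pathological

end UAlgebra

namespace UAlgebra

variable {σ : Signature}

section LocalMaltsev

variable {ι : Type*} {B : ι → UAlgebra σ}

theorem exists_maltsev_of_left
    (hfin : (Set.range fun (t : Term σ 3) (i : ι) => t.eval (B i)).Finite)
    (hid : ∀ i, (B i).Idempotent) {i : ι} {a b : (B i).carrier}
    (hloc : ∀ (j : ι) (c d : (B j).carrier), ∃ s : Term σ 3,
      s.eval (B i) ![a, b, b] = a ∧ s.eval (B j) ![c, c, d] = d) :
    ∃ t : Term σ 3, t.eval (B i) ![a, b, b] = a ∧
      ∀ (j : ι) (c d : (B j).carrier), t.eval (B j) ![c, c, d] = d := by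
  let good : Term σ 3 → Set (Σ j, (B j).carrier × (B j).carrier) := fun t =>
    {x | t.eval (B x.1) ![x.2.1, x.2.1, x.2.2] = x.2.2}
  have hgood : (good '' {t | t.eval (B i) ![a, b, b] = a}).Finite := by
    refine (hfin.image fun (g : ∀ i, (Fin 3 → (B i).carrier) → (B i).carrier) =>
      {x : Σ j, (B j).carrier × (B j).carrier |
        g x.1 ![x.2.1, x.2.1, x.2.2] = x.2.2}).subset ?_
    rintro _ ⟨t, -, rfl⟩
    exact ⟨_, ⟨t, rfl⟩, rfl⟩
  obtain ⟨t, ht⟩ := Set.Finite.exists_maximalFor' good _ hgood ⟨.var 0, rfl⟩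
  refine ⟨t, ht.1, fun j c d => ?_⟩
  obtain ⟨s, hs1, hs2⟩ := hloc j (t.eval (B j) ![c, c, d]) d
  let r : Term σ 3 := s.comp3 t (t.comp3 (.var 1) (.var 1) (.var 2)) (.var 2)
  have hr : r ∈ {t : Term σ 3 | t.eval (B i) ![a, b, b] = a} := by
    change r.eval _ _ = _
    simp [r, (show t.eval (B i) ![a, b, b] = a from ht.1), (hid i).eval3, hs1]
  have hle : good t ≤ good r := by
    rintro ⟨k, c', d'⟩ h
    replace h : t.eval (B k) ![c', c', d'] = d' := h
    change r.eval _ _ = _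
    simp [r, h, (hid k).eval3]
  have hge := ht.2 hr hle
  have : (⟨j, c, d⟩ : Σ j, (B j).carrier × (B j).carrier) ∈ good r := by
    change r.eval _ _ = _
    simp [r, hs2]
  exact hge this

/-- Local Mal'tsev operations can be combined into a global one. -/
theorem exists_maltsev_of_local
    (hfin : (Set.range fun (t : Term σ 3) (i : ι) => t.eval (B i)).Finite)
    (hid : ∀ i, (B i).Idempotent)
    (hloc : ∀ (i : ι) (a b : (B i).carrier) (j : ι) (c d : (B j).carrier), ∃ s : Term σ 3,
      s.eval (B i) ![a, b, b] = a ∧ s.eval (B j) ![c, c, d] = d) :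
    ∃ t : Term σ 3, ∀ (i : ι) (a b : (B i).carrier),
      t.eval (B i) ![a, b, b] = a ∧ t.eval (B i) ![b, b, a] = a := by
  by_cases hne : Nonempty (Σ i, (B i).carrier × (B i).carrier)
  swap
  · exact ⟨.var 0, fun i a b => absurd ⟨⟨i, a, b⟩⟩ hne⟩
  obtain ⟨i₀, a₀, b₀⟩ := hne.some
  have hleft := fun i a b => exists_maltsev_of_left hfin hid (hloc i a b)
  obtain ⟨t₀, -, ht₀⟩ := hleft i₀ a₀ b₀
  let good : Term σ 3 → Set (Σ j, (B j).carrier × (B j).carrier) := fun t =>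
    {x | t.eval (B x.1) ![x.2.1, x.2.2, x.2.2] = x.2.1}
  have hgood : (good '' {t | ∀ (j : ι) (c d : (B j).carrier),
      t.eval (B j) ![c, c, d] = d}).Finite := by
    refine (hfin.image fun (g : ∀ i, (Fin 3 → (B i).carrier) → (B i).carrier) =>
      {x : Σ j, (B j).carrier × (B j).carrier |
        g x.1 ![x.2.1, x.2.2, x.2.2] = x.2.1}).subset ?_
    rintro _ ⟨t, -, rfl⟩
    exact ⟨_, ⟨t, rfl⟩, rfl⟩
  obtain ⟨t, ht⟩ := Set.Finite.exists_maximalFor' good _ hgood ⟨t₀, ht₀⟩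
  have htr : ∀ (j : ι) (c d : (B j).carrier), t.eval (B j) ![c, c, d] = d := ht.1
  refine ⟨t, fun i a b => ⟨?_, htr i b a⟩⟩
  obtain ⟨s, hs1, hs2⟩ := hleft i a (t.eval (B i) ![a, b, b])
  let r : Term σ 3 := s.comp3 (.var 0) (t.comp3 (.var 0) (.var 1) (.var 1)) t
  have hr : r ∈ {t : Term σ 3 | ∀ (j : ι) (c d : (B j).carrier),
      t.eval (B j) ![c, c, d] = d} := by
    intro j c d
    simp [r, htr, hs2]
  have hle : good t ≤ good r := by
    rintro ⟨k, c', d'⟩ h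
    replace h : t.eval (B k) ![c', d', d'] = c' := h
    change r.eval _ _ = _
    simp [r, h, (hid k).eval3]
  have hge := ht.2 hr hle
  have : (⟨i, a, b⟩ : Σ j, (B j).carrier × (B j).carrier) ∈ good r := by
    change r.eval _ _ = _
    simp [r, hs1]
  exact hge this

end LocalMaltsev

section Affine

variable {Q : UAlgebra σ}

/-- A term commuting with every term. -/
def Central (Q : UAlgebra σ) (p : Term σ 3) : Prop :=
  ∀ (n : ℕ) (t : Term σ n) (u v w : Fin n → Q.carrier),
    p.eval Q ![t.eval Q u, t.eval Q v, t.eval Q w] =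
      t.eval Q fun i => p.eval Q ![u i, v i, w i]

theorem Central.medial {p : Term σ 3} (hc : Q.Central p) (a b c d e f g k l : Q.carrier) :
    p.eval Q ![p.eval Q ![a, b, c], p.eval Q ![d, e, f], p.eval Q ![g, k, l]] =
      p.eval Q ![p.eval Q ![a, d, g], p.eval Q ![b, e, k], p.eval Q ![c, f, l]] := by
  rw [hc 3 p ![a, b, c] ![d, e, f] ![g, k, l]]
  congr 1
  funext i
  fin_cases i <;> rfl

theorem Central.exists_addCommGroup {p : Term σ 3} (hc : Q.Central p)
    (o : Q.carrier) (hp : ∀ x y : Q.carrier, p.eval Q ![x, y, y] = x ∧ p.eval Q ![y, y, x] = x) :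
    ∃ _ : AddCommGroup Q.carrier, ∀ x y z : Q.carrier, p.eval Q ![x, y, z] = x - y + z := by
  have hl : ∀ x y : Q.carrier, p.eval Q ![x, y, y] = x := fun x y => (hp x y).1
  have hr : ∀ x y : Q.carrier, p.eval Q ![y, y, x] = x := fun x y => (hp x y).2
  have hassoc : ∀ x y z : Q.carrier, p.eval Q ![p.eval Q ![x, o, y], o, z] =
      p.eval Q ![x, o, p.eval Q ![y, o, z]] := by
    intro x y z
    have := hc.medial x o y o o o o o z
    simpa only [hl, hr] using this
  have hcomm : ∀ x y : Q.carrier, p.eval Q ![x, o, y] = p.eval Q ![y, o, x] := by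
    intro x y
    have := hc.medial o o x o o o y o o
    simpa only [hl, hr] using this
  have hneg : ∀ x : Q.carrier, p.eval Q ![p.eval Q ![o, x, o], o, x] = o := by
    intro x
    have := hc.medial o x o o o o o o x
    simpa only [hl, hr] using this
  let _ : Add Q.carrier := ⟨fun x y => p.eval Q ![x, o, y]⟩
  let _ : Zero Q.carrier := ⟨o⟩
  let _ : Neg Q.carrier := ⟨fun x => p.eval Q ![o, x, o]⟩
  let inst : AddCommGroup Q.carrier :=
    { add_assoc := hassoc
      zero_add := fun x => hr x o
      add_zero := fun x => hl x o
      add_comm := hcomm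
      neg_add_cancel := hneg
      nsmul := nsmulRec
      zsmul := zsmulRec }
  refine ⟨inst, fun x y z => ?_⟩
  rw [sub_eq_add_neg]
  change _ = p.eval Q ![p.eval Q ![x, o, p.eval Q ![o, y, o]], o, z]
  have h1 := hc.medial x o o o o o o y o
  have h2 := hc.medial x y o o o o o o z
  simp only [hl, hr] at h1 h2
  rw [h1, h2]

variable [AddCommGroup Q.carrier]

theorem eval_add_of_central {p : Term σ 3} (hc : Q.Central p) (hQ : Q.Idempotent)
    (hp : ∀ x y z : Q.carrier, p.eval Q ![x, y, z] = x - y + z) {n : ℕ} (t : Term σ n)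
    (u v : Fin n → Q.carrier) : t.eval Q (u + v) = t.eval Q u + t.eval Q v := by
  have := hc n t u (fun _ => 0) v
  rw [hQ.eval_const, hp, sub_zero] at this
  rw [this]
  congr 1
  funext i
  simp [hp]

/-- The endomorphisms `r` for which `y + r (x - y)` is a term operation. -/
def coefficientRing (p : Term σ 3)
    (hp : ∀ x y z : Q.carrier, p.eval Q ![x, y, z] = x - y + z) :
    Subring (AddMonoid.End Q.carrier) where
  carrier := {r | ∃ b : Term σ 2, ∀ x y : Q.carrier, b.eval Q ![x, y] = y + r (x - y)}
  zero_mem' := ⟨.var 1, fun x y => by simp⟩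
  one_mem' := ⟨.var 0, fun x y => by simp⟩
  mul_mem' := by
    rintro r s ⟨b, hb⟩ ⟨c, hc⟩
    exact ⟨b.comp2 c (.var 1), fun x y => by simp [hb, hc]⟩
  add_mem' := by
    rintro r s ⟨b, hb⟩ ⟨c, hc⟩
    refine ⟨p.comp3 b (.var 1) c, fun x y => ?_⟩
    simp only [Term.eval_comp3, Term.eval_var, hb, hc, hp]
    change y + r (x - y) - y + (y + s (x - y)) = y + (r (x - y) + s (x - y))
    abel
  neg_mem' := by
    rintro r ⟨b, hb⟩
    refine ⟨p.comp3 (.var 1) b (.var 1), fun x y => ?_⟩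
    simp only [Term.eval_comp3, Term.eval_var, hb, hp]
    change y - (y + r (x - y)) + y = y + -r (x - y)
    abel

theorem exists_coefficients {p : Term σ 3} (hc : Q.Central p) (hQ : Q.Idempotent)
    (hp : ∀ x y z : Q.carrier, p.eval Q ![x, y, z] = x - y + z) {n : ℕ} (t : Term σ n) :
    ∃ c : Fin n → coefficientRing p hp, ∑ i, c i = 1 ∧
      ∀ x, t.eval Q x = ∑ i, c i • x i := by
  let T : (Fin n → Q.carrier) →+ Q.carrier :=
    AddMonoidHom.mk' (t.eval Q) (eval_add_of_central hc hQ hp t)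
  have hT : ∀ x, t.eval Q x = ∑ i, T (Pi.single i (x i)) := by
    intro x
    rw [← map_sum, Finset.univ_sum_single]
    rfl
  let e : Fin n → AddMonoid.End Q.carrier := fun i =>
    T.comp (AddMonoidHom.single (fun _ : Fin n => Q.carrier) i)
  have he : ∀ i, e i ∈ coefficientRing p hp := by
    intro i
    refine ⟨t.subst (Function.update (fun _ => .var 1) i (.var 0)), fun x y => ?_⟩
    rw [Term.eval_subst]
    have : (fun j => (Function.update (fun _ => (.var 1 : Term σ 2)) i (.var 0) j).eval Q ![x, y]) =
        (fun _ => y) + Pi.single i (x - y) := by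
      funext j
      by_cases hj : j = i
      · subst hj
        simp
      · simp [hj]
    rw [this, eval_add_of_central hc hQ hp, hQ.eval_const]
    rfl
  refine ⟨fun i => ⟨e i, he i⟩, ?_, hT⟩
  apply Subtype.ext
  ext y
  have h := hT fun _ => y
  rw [hQ.eval_const] at h
  rw [AddSubmonoidClass.coe_finsetSum]
  exact (AddMonoidHom.finsetSum_apply _ _ _).trans h.symm

theorem exists_term_of_coefficients {p : Term σ 3}
    (hp : ∀ x y z : Q.carrier, p.eval Q ![x, y, z] = x - y + z) {n : ℕ}
    (c : Fin (n + 1) → coefficientRing p hp) (hc : ∑ i, c i = 1) :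
    ∃ t : Term σ (n + 1), ∀ x, t.eval Q x = ∑ i, c i • x i := by
  have key : ∀ s : Finset (Fin (n + 1)), ∃ t : Term σ (n + 1), ∀ x : Fin (n + 1) → Q.carrier,
      t.eval Q x = x 0 + ∑ i ∈ s, c i • (x i - x 0) := by
    intro s
    induction s using Finset.induction_on with
    | empty => exact ⟨.var 0, fun x => by simp⟩
    | insert i s hi ih =>
      obtain ⟨t, ht⟩ := ih
      obtain ⟨b, hb⟩ := (c i).2
      refine ⟨p.comp3 t (.var 0) (b.comp2 (.var i) (.var 0)), fun x => ?_⟩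
      rw [Finset.sum_insert hi]
      simp only [Term.eval_comp3, Term.eval_comp2, Term.eval_var, hb, hp, ht]
      change _ = x 0 + ((c i : AddMonoid.End Q.carrier) (x i - x 0) + _)
      abel
  obtain ⟨t, ht⟩ := key Finset.univ
  refine ⟨t, fun x => ?_⟩
  rw [ht]
  simp only [smul_sub, Finset.sum_sub_distrib, ← Finset.sum_smul, hc, one_smul]
  abel

end Affine

theorem Central.isAffineAlgebra {Q : UAlgebra σ} {p : Term σ 3} (hc : Q.Central p)
    (hfin : Finite Q.carrier) (hnt : Nontrivial Q.carrier) (hQ : Q.Idempotent)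
    (hp : ∀ x y : Q.carrier, p.eval Q ![x, y, y] = x ∧ p.eval Q ![y, y, x] = x) :
    Q.IsAffineAlgebra := by
  obtain ⟨inst, hp'⟩ := hc.exists_addCommGroup hnt.to_nonempty.some hp
  have hfe : Finite (AddMonoid.End Q.carrier) :=
    Finite.of_injective (fun f x => f x) DFunLike.coe_injective
  refine ⟨coefficientRing p hp', inferInstance, inferInstance, inst, inferInstance,
    fun n g => ⟨?_, ?_⟩, p, hp'⟩
  · rintro ⟨t, ht⟩
    obtain ⟨c, h1, h2⟩ := exists_coefficients hc hQ hp' t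
    exact ⟨c, h1, fun x => by rw [← ht, h2]⟩
  · rintro ⟨c, h1, h2⟩
    cases n with
    | zero =>
      exfalso
      obtain ⟨x, y, hxy⟩ := hnt
      have h0 : (0 : coefficientRing p hp') = 1 := by simpa using h1
      apply hxy
      rw [← one_smul (coefficientRing p hp') x, ← one_smul (coefficientRing p hp') y, ← h0,
        zero_smul, zero_smul]
    | succ n =>
      obtain ⟨t, ht⟩ := exists_term_of_coefficients hp' c h1
      exact ⟨t, fun x => by rw [ht, h2]⟩

end UAlgebra

namespace UAlgebra

variable {σ : Signature}

/-- A term Mal'tsev operation commuting with every term. -/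
def HasCentralMaltsev (Q : UAlgebra σ) : Prop :=
  ∃ p : Term σ 3, Q.Central p ∧
    ∀ x y : Q.carrier, p.eval Q ![x, y, y] = x ∧ p.eval Q ![y, y, x] = x

theorem HasCentralMaltsev.of_injective {C Q : UAlgebra σ} (hQ : Q.HasCentralMaltsev)
    {φ : C.carrier → Q.carrier} (hφ : IsHom C Q φ) (hi : Function.Injective φ) :
    C.HasCentralMaltsev := by
  obtain ⟨p, hc, hp⟩ := hQ
  refine ⟨p, fun n t u v w => hi ?_, fun x y => ⟨hi ?_, hi ?_⟩⟩
  · rw [hφ.eval3, hφ.eval, hφ.eval, hφ.eval, hφ.eval, hc]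
    simp only [hφ.eval3]
  · rw [hφ.eval3, (hp _ _).1]
  · rw [hφ.eval3, (hp _ _).2]

namespace Pathological

variable {H : Term σ 3 → Prop} {h : Term σ 3} {Q : UAlgebra σ} (P : Pathological H h Q)

include P

theorem exists_maltsev : ∃ p : Term σ 3, ∀ x y : Q.carrier,
    p.eval Q ![x, y, y] = x ∧ p.eval Q ![y, y, x] = x := by
  have := P.fin
  obtain ⟨p, hp⟩ := exists_maltsev_of_local (B := fun _ : Unit => Q) (Set.toFinite _)
    (fun _ => P.idem) (fun _ a b _ c d => P.exists_local_maltsev a b c d)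
  exact ⟨p, hp ()⟩

theorem hasCentralMaltsev : Q.HasCentralMaltsev := by
  obtain ⟨p, hp⟩ := P.exists_maltsev
  obtain ⟨q, hq, hl, hr⟩ := P.exists_quasigroup
  obtain ⟨o, -⟩ := P.exists_not_mut
  refine ⟨p, fun n t u v w => ?_, hp⟩
  have key : ∀ x s z, p.eval Q ![q x s, q o s, q o z] = q x z := by
    intro x s z
    have := hq 3 p ![x, o, o] ![s, s, z]
    rw [(hp _ _).1, (hp _ _).2] at this
    rw [this]
    congr 1
    funext i
    fin_cases i <;> rfl
  choose s hs using fun i => (hl o).2 (v i)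
  choose x hx using fun i => (hr (s i)).2 (u i)
  choose z hz using fun i => (hl o).2 (w i)
  obtain rfl : (fun i => q (x i) (s i)) = u := funext hx
  obtain rfl : (fun i => q o (s i)) = v := funext hs
  obtain rfl : (fun i => q o (z i)) = w := funext hz
  have ho : t.eval Q (fun _ => o) = o := P.idem.eval_const t o
  have h1 := hq n t (fun _ => o) s
  have h2 := hq n t (fun _ => o) z
  rw [ho] at h1 h2
  rw [← hq, ← h1, ← h2, key]
  simp only [key]
  exact hq n t x z

end Pathological

theorem maxReachable_of_simple {H : Term σ 3 → Prop} {h : Term σ 3} {Q : UAlgebra σ}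
    (hfin : Finite Q.carrier) (hQ : Q.Idempotent) (hsim : Q.IsSimple)
    (hproper : ProperReachable H h Q)
    (hmaj : ∀ a b : Q.carrier, a ≠ b → Q.ClosureSet {a, b} = Set.univ →
      (¬ ∃ t : Term σ 2, IsSemilatticeOn (fun x y => t.eval Q ![x, y]) {a, b}) →
      ¬ ∃ t : Term σ 3, IsMajorityOn (fun x y z => t.eval Q ![x, y, z]) {a, b})
    (hset : ¬ Q.IsSetAlgebra)
    (haff : Q.HasCentralMaltsev → ∀ h', H h' → ∀ a b : Q.carrier, a ≠ b →
      Q.ClosureSet {a, b} = Set.univ →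
      IsMaltsevOn (fun x y z => h'.eval Q ![x, y, z]) {a, b})
    (hh : H h) : MaxReachable H h Q := by
  by_contra hbad
  have P : Pathological H h Q := ⟨hfin, hQ, hsim, hproper, hmaj, hset, hbad⟩
  have key : ∀ h', H h' → ∀ a b : Q.carrier, a ≠ b →
      h'.eval Q ![b, a, a] = b ∧ h'.eval Q ![a, a, b] = b := fun h' hh' a b hab =>
    haff P.hasCentralMaltsev h' hh' a b hab (P.closure_pair_eq_univ hab) b (by simp) a (by simp)
  have hgood : ∀ a b : Q.carrier, a ≠ b → GReach H h Q a b := fun a b hab => by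
    refine .single (Or.inr ⟨(key h hh a b hab).1, ?_, fun h' hh' => ⟨.var 1, ?_⟩⟩)
    · rw [(key h hh b a hab.symm).2]
      exact hab
    · exact (key h' hh' a b hab).2
  obtain ⟨a, b, -, -, hab⟩ := P.exists_not_mut
  have hne := Pathological.ne_of_not_mut hab
  exact hab ⟨hgood a b hne, hgood b a hne.symm⟩

/-- `B` is a homomorphic image of a subalgebra of `A`. -/
def IsDivisor (A B : UAlgebra σ) : Prop :=
  ∃ (S : Set A.carrier) (hS : A.IsClosed S) (φ : (A.subalg S hS).carrier → B.carrier),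
    IsHom (A.subalg S hS) B φ ∧ Function.Surjective φ

theorem isDivisor_refl (A : UAlgebra σ) : IsDivisor A A :=
  ⟨Set.univ, fun _ _ _ => trivial, Subtype.val, fun _ _ => rfl, fun x => ⟨⟨x, trivial⟩, rfl⟩⟩

namespace IsDivisor

variable {A B : UAlgebra σ}

theorem quot (hB : IsDivisor A B) (θ : Congruence B) : IsDivisor A (B.quot θ) := by
  obtain ⟨S, hS, φ, hφ, hs⟩ := hB
  exact ⟨S, hS, _, (quot_mk_isHom B θ).comp hφ, Quotient.mk_surjective.comp hs⟩

theorem subalg (hB : IsDivisor A B) (D : Set B.carrier) (hD : B.IsClosed D) :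
    IsDivisor A (B.subalg D hD) := by
  obtain ⟨S, hS, φ, hφ, hs⟩ := hB
  have hT : A.IsClosed {x | ∃ hx : x ∈ S, φ ⟨x, hx⟩ ∈ D} := by
    intro f x hx
    refine ⟨hS f x fun j => (hx j).1, ?_⟩
    have := hφ f fun j => ⟨x j, (hx j).1⟩
    change φ ⟨A.interp f x, _⟩ = _ at this
    rw [this]
    exact hD f _ fun j => (hx j).2
  refine ⟨_, hT, fun x => ⟨φ ⟨x.1, x.2.1⟩, x.2.2⟩, fun f x => ?_, fun y => ?_⟩
  · apply Subtype.ext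
    exact hφ f fun j => ⟨(x j).1, (x j).2.1⟩
  · obtain ⟨x, hx⟩ := hs y.1
    exact ⟨⟨x.1, x.2, hx ▸ y.2⟩, Subtype.ext hx⟩

theorem finite (hB : IsDivisor A B) (hA : Finite A.carrier) : Finite B.carrier := by
  obtain ⟨S, hS, φ, -, hs⟩ := hB
  have : Finite (A.subalg S hS).carrier := inferInstanceAs (Finite {x // x ∈ S})
  exact Finite.of_surjective φ hs

theorem idempotent (hB : IsDivisor A B) (hA : A.Idempotent) : B.Idempotent := by
  obtain ⟨S, hS, φ, hφ, hs⟩ := hB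
  exact hφ.idempotent hs (hA.subalg S hS)

theorem eval_congr (hB : IsDivisor A B) {n : ℕ} {t t' : Term σ n} (h : t.eval A = t'.eval A) :
    t.eval B = t'.eval B := by
  obtain ⟨S, hS, φ, hφ, hs⟩ := hB
  funext v
  choose u hu using fun i => hs (v i)
  obtain rfl : (fun i => φ (u i)) = v := funext hu
  rw [← hφ.eval, ← hφ.eval]
  congr 1
  apply Subtype.ext
  rw [(subalg_val_isHom A S hS).eval, (subalg_val_isHom A S hS).eval, h]

theorem of_mem_quotSub (hB : B ∈ QuotSub A) : IsDivisor A B := by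
  obtain ⟨S, hS, θ, rfl⟩ := hB
  exact ((isDivisor_refl A).subalg S hS).quot θ

end IsDivisor

/-- Terms acting as a Mal'tsev operation on every affine divisor. -/
theorem exists_maltsev_on_affine (A : UAlgebra σ) (hfin : Finite A.carrier) (hA : A.Idempotent) :
    ∃ t : Term σ 3, ∀ B, IsDivisor A B → B.IsAffineAlgebra → ∀ a b : B.carrier,
      t.eval B ![a, b, b] = a ∧ t.eval B ![b, b, a] = a := by
  let ι := {B : UAlgebra σ // IsDivisor A B ∧ B.IsAffineAlgebra}
  let f : Term σ 3 → ∀ i : ι, (Fin 3 → i.1.carrier) → i.1.carrier := fun t i => t.eval i.1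
  have hfac : f.FactorsThrough fun t => t.eval A := fun t t' h =>
    funext fun i => i.2.1.eval_congr h
  have hrange : (Set.range f).Finite := by
    refine (Set.finite_range (Function.extend (fun t : Term σ 3 => t.eval A) f
      fun _ => f (.var 0))).subset ?_
    rintro _ ⟨t, rfl⟩
    exact ⟨t.eval A, hfac.extend_apply _ t⟩
  have hid : ∀ i : ι, i.1.Idempotent := fun i => i.2.1.idempotent hA
  suffices hloc : ∀ (i : ι) (a b : i.1.carrier) (j : ι) (c d : j.1.carrier), ∃ s : Term σ 3,
      s.eval i.1 ![a, b, b] = a ∧ s.eval j.1 ![c, c, d] = d by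
    obtain ⟨t, ht⟩ := exists_maltsev_of_local (B := fun i : ι => i.1) hrange hid hloc
    exact ⟨t, fun B h1 h2 => ht ⟨B, h1, h2⟩⟩
  intro i a b j c d
  obtain ⟨Ri, _, _, _, _, -, s, hs⟩ := i.2.2
  obtain ⟨Rj, _, _, _, _, hj, t, ht⟩ := j.2.2
  obtain ⟨e, he1, he⟩ := (hj 3 (s.eval j.1)).mp ⟨s, fun _ => rfl⟩
  refine ⟨t.comp3 (s.comp3 (.var 2) (.var 1) (.var 0)) (.var 0)
    (s.comp3 (.var 0) (.var 2) (.var 2)), ?_, ?_⟩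
  · simp [hs, (hid i).eval3]
  · rw [Fin.sum_univ_three] at he1
    have h0 : e 0 = 1 - e 1 - e 2 := by rw [← he1]; abel
    simp only [Term.eval_comp3, Term.eval_var, ht, he, Fin.sum_univ_three]
    simp only [Matrix.cons_val, h0, sub_smul, one_smul]
    abel

end UAlgebra

namespace UAlgebra

variable {σ : Signature}

/-- A term satisfying the requirements of the minority condition on all divisors. -/
theorem exists_minority (A : UAlgebra σ) (hfin : Finite A.carrier) (hA : A.Idempotent) :
    ∃ t : Term σ 3, ∀ B, IsDivisor A B →
      (∀ x y : B.carrier, t.eval B ![t.eval B ![x, y, y], y, y] = t.eval B ![x, y, y]) ∧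
      (B.IsAffineAlgebra → ∀ a b : B.carrier,
        t.eval B ![a, b, b] = a ∧ t.eval B ![b, b, a] = a) := by
  obtain ⟨h, hh⟩ := exists_maltsev_on_affine A hfin hA
  let T : Term σ 2 := h.comp3 (.var 1) (.var 0) (.var 0)
  obtain ⟨N, hN, hidem⟩ := Term.exists_iter_idem A T
  obtain ⟨k, rfl⟩ := Nat.exists_eq_succ_of_ne_zero hN.ne'
  let t : Term σ 3 := h.comp3 ((T.iter k).comp2 (.var 1) (.var 0)) (.var 1) (.var 2)
  have ht : ∀ (B : UAlgebra σ) (x y : B.carrier),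
      t.eval B ![x, y, y] = (T.iter (k + 1)).eval B ![y, x] := fun B x y => by
    simp [t, T, Term.iter]
  refine ⟨t, fun B hB => ⟨fun x y => ?_, fun hB' a b => ?_⟩⟩
  · have hc : ((T.iter (k + 1)).comp2 (.var 0) (T.iter (k + 1))).eval A =
        (T.iter (k + 1)).eval A := by
      funext v
      have hv : ![v 0, v 1] = v := by
        funext i
        fin_cases i <;> rfl
      have h01 := hidem (v 0) (v 1)
      rw [hv] at h01
      simpa using h01
    have := congrFun (hB.eval_congr hc) ![y, x]
    rw [ht, ht]
    simpa using this
  · have hT : ∀ x y, T.eval B ![y, x] = x := fun x y => by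
      simp [T, (hh B hB hB' x y).1]
    constructor
    · rw [ht, Term.eval_iter]
      exact Function.iterate_fixed (hT a b) _
    · have hb : (T.iter k).eval B ![b, b] = b := (hB.idempotent hA).eval2 _ _
      simp [t, hb, (hh B hB hB' a b).2]

section Transfer

variable {A B : UAlgebra σ} {φ : A.carrier → B.carrier}

theorem IsHom.isSemilatticeOn (hφ : IsHom A B φ) {t : Term σ 2} {a b : A.carrier}
    (h : IsSemilatticeOn (fun x y => t.eval A ![x, y]) {a, b}) :
    IsSemilatticeOn (fun x y => t.eval B ![x, y]) {φ a, φ b} := by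
  rw [← Set.image_pair]
  refine ⟨?_, ?_, ?_⟩
  · rintro _ ⟨x, hx, rfl⟩
    simp only [← hφ.eval2]
    exact congrArg φ (h.1 x hx)
  · rintro _ ⟨x, hx, rfl⟩ _ ⟨y, hy, rfl⟩
    simp only [← hφ.eval2]
    exact congrArg φ (h.2.1 x hx y hy)
  · rintro _ ⟨x, hx, rfl⟩ _ ⟨y, hy, rfl⟩ _ ⟨z, hz, rfl⟩
    simp only [← hφ.eval2]
    exact congrArg φ (h.2.2 x hx y hy z hz)

theorem IsHom.isMaltsevOn (hφ : IsHom A B φ) {t : Term σ 3} {a b : A.carrier}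
    (h : IsMaltsevOn (fun x y z => t.eval A ![x, y, z]) {a, b}) :
    IsMaltsevOn (fun x y z => t.eval B ![x, y, z]) {φ a, φ b} := by
  rw [← Set.image_pair]
  rintro _ ⟨x, hx, rfl⟩ _ ⟨y, hy, rfl⟩
  simp only [← hφ.eval3]
  exact ⟨congrArg φ (h x hx y hy).1, congrArg φ (h x hx y hy).2⟩

theorem IsHom.isMajorityOn_of_injective (hφ : IsHom A B φ) (hi : Function.Injective φ)
    {t : Term σ 3} {a b : A.carrier}
    (h : IsMajorityOn (fun x y z => t.eval B ![x, y, z]) {φ a, φ b}) :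
    IsMajorityOn (fun x y z => t.eval A ![x, y, z]) {a, b} := by
  intro x hx y hy
  rw [← Set.image_pair] at h
  have := h _ (Set.mem_image_of_mem φ hx) _ (Set.mem_image_of_mem φ hy)
  simp only [← hφ.eval3] at this
  exact ⟨hi this.1, hi this.2.1, hi this.2.2⟩

theorem IsHom.isSetAlgebra_of_injective (hφ : IsHom A B φ) (hi : Function.Injective φ)
    (h : B.IsSetAlgebra) : A.IsSetAlgebra := by
  intro n t
  obtain ⟨i, hi'⟩ := h n t
  exact ⟨i, fun x => hi (by rw [hφ.eval, hi'])⟩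

theorem IsHom.exists_quot_ker (hφ : IsHom A B φ) (hs : Function.Surjective φ) :
    ∃ ψ : (A.quot hφ.ker).carrier → B.carrier, IsHom (A.quot hφ.ker) B ψ ∧
      Function.Bijective ψ ∧ ∀ x, ψ (Quotient.mk hφ.ker.toSetoid x) = φ x := by
  let ψ : (A.quot hφ.ker).carrier → B.carrier := Quotient.lift φ fun _ _ h => h
  have hψ : ∀ x, ψ (Quotient.mk hφ.ker.toSetoid x) = φ x := fun _ => rfl
  refine ⟨ψ, ?_, ⟨?_, ?_⟩, hψ⟩
  · intro f x
    have hx : (fun j => ψ (x j)) = fun j => φ (x j).out := funext fun j =>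
      (congrArg ψ (Quotient.out_eq (s := hφ.ker.toSetoid) (x j))).symm
    rw [hx, ← hφ f]
    rfl
  · intro x y
    induction x using Quotient.inductionOn with
    | _ x =>
      induction y using Quotient.inductionOn with
      | _ y => exact fun h => Quotient.sound h
  · intro y
    obtain ⟨x, rfl⟩ := hs y
    exact ⟨_, hψ x⟩

theorem IsHom.ker_isMaximal (hφ : IsHom A B φ) (hs : Function.Surjective φ) (hB : B.IsSimple)
    (hnt : Nontrivial B.carrier) : hφ.ker.IsMaximal := by
  constructor
  · intro hfull
    obtain ⟨x, y, hxy⟩ := hnt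
    obtain ⟨x, rfl⟩ := hs x
    obtain ⟨y, rfl⟩ := hs y
    exact hxy (hfull x y)
  · intro η hle hη x y hxy
    let θ : Congruence B :=
      { rel := fun u v => ∃ x y, φ x = u ∧ φ y = v ∧ η.rel x y
        refl := fun u => by
          obtain ⟨x, rfl⟩ := hs u
          exact ⟨x, x, rfl, rfl, η.refl x⟩
        symm := by
          rintro u v ⟨x, y, h1, h2, h3⟩
          exact ⟨y, x, h2, h1, η.symm h3⟩
        trans := by
          rintro u v w ⟨x, y, h1, h2, h3⟩ ⟨y', z, h4, h5, h6⟩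
          exact ⟨x, z, h1, h5, η.trans h3 (η.trans (hle y y' (h2.trans h4.symm)) h6)⟩
        compat := by
          intro f u v huv
          choose x y h1 h2 h3 using huv
          refine ⟨A.interp f x, A.interp f y, ?_, ?_, η.compat f x y h3⟩
          · rw [hφ, funext h1]
          · rw [hφ, funext h2] }
    rcases hB θ with h | h
    · exact (h _ _).mp ⟨x, y, rfl, rfl, hxy⟩
    · exfalso
      apply hη
      intro u v
      obtain ⟨u', v', h1, h2, h3⟩ := h (φ u) (φ v)
      exact η.trans (hle u u' h1.symm) (η.trans h3 (hle v' v h2))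

/-- A simple divisor generated by two elements is represented by a maximal congruence of a
two-generated subalgebra. -/
theorem exists_maximal_quot {S : Set A.carrier} {hS : A.IsClosed S}
    {φ : (A.subalg S hS).carrier → B.carrier} (hφ : IsHom (A.subalg S hS) B φ)
    (hB : B.IsSimple) (a b : (A.subalg S hS).carrier) (hab : φ a ≠ φ b)
    (hgen : B.ClosureSet {φ a, φ b} = Set.univ) :
    ∃ θ : Congruence (A.Sg {a.1, b.1}), θ.IsMaximal ∧
      ∃ ψ : ((A.Sg {a.1, b.1}).quot θ).carrier → B.carrier,
        IsHom ((A.Sg {a.1, b.1}).quot θ) B ψ ∧ Function.Bijective ψ ∧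
          ψ (A.qa a.1 b.1 θ) = φ a ∧ ψ (A.qb a.1 b.1 θ) = φ b := by
  have hsub : A.ClosureSet {a.1, b.1} ⊆ S := ClosureSet_subset hS <| by
    rintro x (rfl | rfl)
    · exact a.2
    · exact b.2
  let χ : (A.Sg {a.1, b.1}).carrier → B.carrier := fun x => φ ⟨x.1, hsub x.2⟩
  have hχ : IsHom (A.Sg {a.1, b.1}) B χ := fun f x => hφ f fun j => ⟨(x j).1, hsub (x j).2⟩
  have hs : Function.Surjective χ := by
    intro y
    obtain ⟨t, rfl⟩ := mem_closureSet_pair.mp (Set.eq_univ_iff_forall.mp hgen y)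
    exact ⟨t.eval _ ![A.sgA a.1 b.1, A.sgB a.1 b.1], hχ.eval2 _ _ _⟩
  obtain ⟨ψ, h1, h2, h3⟩ := hχ.exists_quot_ker hs
  exact ⟨hχ.ker, hχ.ker_isMaximal hs hB ⟨_, _, hab⟩, ψ, h1, h2, h3 _, h3 _⟩

theorem exists_maximal_quot_of_hom (hφ : IsHom A B φ) (hB : B.IsSimple) (a b : A.carrier)
    (hab : φ a ≠ φ b) (hgen : B.ClosureSet {φ a, φ b} = Set.univ) :
    ∃ θ : Congruence (A.Sg {a, b}), θ.IsMaximal ∧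
      ∃ ψ : ((A.Sg {a, b}).quot θ).carrier → B.carrier,
        IsHom ((A.Sg {a, b}).quot θ) B ψ ∧ Function.Bijective ψ ∧
          ψ (A.qa a b θ) = φ a ∧ ψ (A.qb a b θ) = φ b :=
  exists_maximal_quot (S := Set.univ) (hS := fun _ _ _ => trivial) (φ := fun x => φ x.1)
    (fun f x => hφ f fun j => (x j).1) hB ⟨a, trivial⟩ ⟨b, trivial⟩ hab hgen

end Transfer

namespace IsDivisor

variable {A Q : UAlgebra σ}

theorem not_isMajorityOn (hQ : IsDivisor A Q) (hmf : A.MajorityFree) (hsim : Q.IsSimple)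
    (a b : Q.carrier) (hab : a ≠ b) (hgen : Q.ClosureSet {a, b} = Set.univ)
    (hsl : ¬ ∃ t : Term σ 2, IsSemilatticeOn (fun x y => t.eval Q ![x, y]) {a, b}) :
    ¬ ∃ t : Term σ 3, IsMajorityOn (fun x y z => t.eval Q ![x, y, z]) {a, b} := by
  rintro ⟨t, ht⟩
  obtain ⟨S, hS, φ, hφ, hs⟩ := hQ
  obtain ⟨a, rfl⟩ := hs a
  obtain ⟨b, rfl⟩ := hs b
  obtain ⟨θ, hθ, ψ, hψ, hbij, ha, hb⟩ := exists_maximal_quot hφ hsim a b hab hgen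
  rw [← ha, ← hb] at ht hsl
  refine hmf a.1 b.1 ⟨fun h => hab (congrArg φ (Subtype.ext h)), θ, hθ,
    ⟨t, hψ.isMajorityOn_of_injective hbij.1 ht⟩, ?_⟩
  rintro ⟨s, hs⟩
  exact hsl ⟨s, hψ.isSemilatticeOn hs⟩

theorem not_isSetAlgebra (hQ : IsDivisor A Q) (h1 : A.OmitsType1) (hnt : Nontrivial Q.carrier) :
    ¬ Q.IsSetAlgebra := by
  intro hset
  obtain ⟨a, b, hab⟩ := hnt
  have hmem : ∀ x ∈ Q.ClosureSet {a, b}, x = a ∨ x = b := by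
    intro x hx
    obtain ⟨t, rfl⟩ := mem_closureSet_pair.mp hx
    obtain ⟨i, hi⟩ := hset 2 t
    rw [hi]
    fin_cases i
    · exact Or.inl rfl
    · exact Or.inr rfl
  have hC : IsDivisor A (Q.Sg {a, b}) := hQ.subalg _ _
  have hCset : (Q.Sg {a, b}).IsSetAlgebra :=
    (subalg_val_isHom Q _ _).isSetAlgebra_of_injective Subtype.val_injective hset
  have hcases : ∀ x : (Q.Sg {a, b}).carrier, x = Q.sgA a b ∨ x = Q.sgB a b := fun x =>
    (hmem x.1 x.2).imp Subtype.ext Subtype.ext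
  have hne : Q.sgA a b ≠ Q.sgB a b := fun h => hab (congrArg Subtype.val h)
  have hsim : (Q.Sg {a, b}).IsSimple := by
    intro θ
    by_cases h : θ.rel (Q.sgA a b) (Q.sgB a b)
    · right
      intro x y
      rcases hcases x with rfl | rfl <;> rcases hcases y with rfl | rfl
      exacts [θ.refl _, h, θ.symm h, θ.refl _]
    · left
      intro x y
      refine ⟨fun hxy => ?_, fun hxy => hxy ▸ θ.refl x⟩
      rcases hcases x with rfl | rfl <;> rcases hcases y with rfl | rfl
      exacts [rfl, absurd hxy h, absurd (θ.symm hxy) h, rfl]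
  obtain ⟨S, hS, φ, hφ, hs⟩ := hC
  obtain ⟨a', ha⟩ := hs (Q.sgA a b)
  obtain ⟨b', hb⟩ := hs (Q.sgB a b)
  rw [← ha, ← hb] at hne hcases
  have hgen : (Q.Sg {a, b}).ClosureSet {φ a', φ b'} = Set.univ :=
    Set.eq_univ_of_forall fun x => Closure.base (hcases x)
  obtain ⟨θ, hθ, ψ, hψ, hbij, -⟩ := exists_maximal_quot_of_hom hφ hsim a' b' hne hgen
  exact h1 S hS a' b' ⟨fun h => hne (congrArg φ h), θ, hθ,
    hψ.isSetAlgebra_of_injective hbij.1 hCset⟩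

theorem isMaltsevOn (hQ : IsDivisor A Q) (hfin : Finite A.carrier) (hA : A.Idempotent)
    (hsim : Q.IsSimple) (hc : Q.HasCentralMaltsev) {t : Term σ 3}
    (ht : MinorityCondition (QuotSub A) t) (a b : Q.carrier) (hab : a ≠ b)
    (hgen : Q.ClosureSet {a, b} = Set.univ) :
    IsMaltsevOn (fun x y z => t.eval Q ![x, y, z]) {a, b} := by
  have hQfin := hQ.finite hfin
  have hQid := hQ.idempotent hA
  obtain ⟨S, hS, φ, hφ, hs⟩ := hQ
  obtain ⟨χ, hχ, hχb, -⟩ := hφ.exists_quot_ker hs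
  obtain ⟨a, rfl⟩ := hχb.2 a
  obtain ⟨b, rfl⟩ := hχb.2 b
  obtain ⟨θ, hθ, ψ, hψ, hbij, ha, hb⟩ := exists_maximal_quot_of_hom hχ hsim a b hab hgen
  have : Nontrivial Q.carrier := ⟨_, _, hab⟩
  obtain ⟨p, hp1, hp2⟩ := hc.of_injective hψ hbij.1
  have haff := hp1.isAffineAlgebra (Finite.of_injective ψ hbij.1) hbij.2.nontrivial
    ((((hA.subalg S hS).quot _).subalg _ _).quot θ) hp2
  have := ht.2 _ ⟨S, hS, hφ.ker, rfl⟩ a b θ (fun h => hab (congrArg χ h)) ⟨hθ, haff⟩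
  rw [← ha, ← hb]
  exact hψ.isMaltsevOn this

end IsDivisor

/-- Every maximal element is reachable from every element in `Gas(A)`. -/
theorem asReach_of_isMaxElem {A : UAlgebra σ} (hfin : Finite A.carrier) (hA : A.Idempotent)
    (h1 : A.OmitsType1) (hmf : A.MajorityFree) (x : A.carrier) {a : A.carrier}
    (ha : A.IsMaxElem a) : asReach (QuotSub A) A x a := by
  obtain ⟨h, hh⟩ := exists_minority A hfin hA
  have hmin : MinorityCondition (QuotSub A) h := by
    refine ⟨fun B hB => (hh B (.of_mem_quotSub hB)).1, fun B hB a b θ _ hθ x _ y _ => ?_⟩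
    exact (hh _ (((IsDivisor.of_mem_quotSub hB).subalg _ _).quot θ)).2 hθ.2 x y
  have key := maxReachable_induction (H := MinorityCondition (QuotSub A)) (h := h) (IsDivisor A)
    (fun Q hQ => hQ.finite hfin) (fun Q hQ => hQ.idempotent hA) (fun Q hQ => (hh Q hQ).1)
    (fun Q hQ => hQ.subalg) (fun Q hQ => hQ.quot)
    (fun Q hQ hsim hnt hp => maxReachable_of_simple (hQ.finite hfin) (hQ.idempotent hA) hsim hp
      (hQ.not_isMajorityOn hmf hsim) (hQ.not_isSetAlgebra h1 hnt)
      (fun hc h' hh' => hQ.isMaltsevOn hfin hA hsim hc hh') hmin)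
    A (isDivisor_refl A) x a ha
  refine Relation.ReflTransGen.mono (fun u v huv => ?_) _ _ key
  rcases huv with huv | ⟨h2, -, h3⟩
  · exact Or.inl huv
  · exact Or.inr ⟨⟨h, hmin, h2⟩, fun t ht => mem_closureSet_pair.mpr (h3 t ht)⟩

end UAlgebra

/-- in a smooth majority free finite idempotent algebra omitting
type 1, every maximal element is as-maximal and there is exactly one
as-component. -/
theorem stmt_9 (σ : Signature) (A : UAlgebra σ)
    (hfin : Finite A.carrier) (hne : Nonempty A.carrier) (hid : A.Idempotent)
    (hsm : A.IsSmooth) (h1 : A.OmitsType1) (hmf : A.MajorityFree) :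
    (∀ a : A.carrier, A.IsMaxElem a → IsAsMaxElem (UAlgebra.QuotSub A) A a) ∧
    (∀ a b : A.carrier, IsAsMaxElem (UAlgebra.QuotSub A) A a →
      IsAsMaxElem (UAlgebra.QuotSub A) A b →
      asReach (UAlgebra.QuotSub A) A a b ∧ asReach (UAlgebra.QuotSub A) A b a) := by
  have key : ∀ a b : A.carrier, IsAsMaxElem (UAlgebra.QuotSub A) A a →
      asReach (UAlgebra.QuotSub A) A b a := by
    intro a b ha
    obtain ⟨m, hm, ham⟩ := A.exists_max_above a
    exact (UAlgebra.asReach_of_isMaxElem hfin hid h1 hmf b hm).trans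
      (ha m (Relation.ReflTransGen.mono (fun _ _ => Or.inl) _ _ ham))
  exact ⟨fun a ha b _ => UAlgebra.asReach_of_isMaxElem hfin hid h1 hmf b ha,
    fun a b ha hb => ⟨key b a hb, key a b ha⟩⟩
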